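/- Let n ≥ 1 and 1 < p ≤ 2. Let u ∈ C²(ℝⁿ₊) ∩ C(cl ℝⁿ₊) be a classical solution of -Δu = |∇u|^p in ℝⁿ₊ with u = 0 on ∂ℝⁿ₊. Then u depends only on the variable xₙ, i.e., u(x', xₙ) = u(y', xₙ) for all x', y' ∈ ℝⁿ⁻¹ and all xₙ ≥ 0. -/

import Mathlib

/-- The classical Laplacian of `u : ℝⁿ → ℝ`: the sum of the pure second
derivatives `∂²u/∂xᵢ²`. -/
noncomputable def laplacian {n : ℕ} (u : EuclideanSpace ℝ (Fin n) → ℝ)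
    (x : EuclideanSpace ℝ (Fin n)) : ℝ :=
  ∑ i, iteratedFDeriv ℝ 2 u x ![EuclideanSpace.single i 1, EuclideanSpace.single i 1]

/-- The open half-space `ℝⁿ₊ = {x ∈ ℝⁿ : xₙ > 0}` (dimension `n + 1`, so `n + 1 ≥ 1`). -/
def halfSpace (n : ℕ) : Set (EuclideanSpace ℝ (Fin (n + 1))) :=
  {x | 0 < x (Fin.last n)}

open Filter Topology

/-- `f` has first derivative `a` and second derivative `b` at `0`. -/
def HasD2 (f : ℝ → ℝ) (a b : ℝ) : Prop :=
  ∃ f' : ℝ → ℝ, (∀ᶠ t in 𝓝 (0 : ℝ), HasDerivAt f (f' t) t) ∧ f' 0 = a ∧ HasDerivAt f' b 0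

namespace HasD2

theorem const (c : ℝ) : HasD2 (fun _ => c) 0 0 :=
  ⟨fun _ => 0, Eventually.of_forall fun t => hasDerivAt_const t c, rfl, hasDerivAt_const _ _⟩

theorem quad (a b c : ℝ) : HasD2 (fun t => a + b * t + c * t ^ 2) b (2 * c) := by
  refine ⟨fun t => b + 2 * c * t, Eventually.of_forall fun t => ?_, by simp, ?_⟩
  · have h := (((hasDerivAt_id t).const_mul b).const_add a).add
      (((hasDerivAt_id t).pow 2).const_mul c)
    refine h.congr_deriv ?_
    simp; ring
  · have h := ((hasDerivAt_id (0:ℝ)).const_mul (2 * c)).const_add b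
    refine h.congr_deriv ?_
    simp

theorem add {f g : ℝ → ℝ} {a b c d : ℝ} (hf : HasD2 f a b) (hg : HasD2 g c d) :
    HasD2 (fun t => f t + g t) (a + c) (b + d) := by
  obtain ⟨f', h1, h2, h3⟩ := hf
  obtain ⟨g', k1, k2, k3⟩ := hg
  refine ⟨fun t => f' t + g' t, ?_, by simp [h2, k2], h3.add k3⟩
  filter_upwards [h1, k1] with t ht kt using ht.add kt

theorem const_mul {f : ℝ → ℝ} {a b : ℝ} (r : ℝ) (hf : HasD2 f a b) :
    HasD2 (fun t => r * f t) (r * a) (r * b) := by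
  obtain ⟨f', h1, h2, h3⟩ := hf
  refine ⟨fun t => r * f' t, ?_, by simp [h2], h3.const_mul r⟩
  filter_upwards [h1] with t ht using ht.const_mul r

theorem congr {f g : ℝ → ℝ} {a b c d : ℝ} (hf : HasD2 f a b) (h : ∀ t, g t = f t)
    (hc : c = a) (hd : d = b) : HasD2 g c d := by
  have : g = f := funext h
  subst this; subst hc; subst hd; exact hf

theorem sub {f g : ℝ → ℝ} {a b c d : ℝ} (hf : HasD2 f a b) (hg : HasD2 g c d) :
    HasD2 (fun t => f t - g t) (a - c) (b - d) :=
  (hf.add (hg.const_mul (-1))).congr (fun t => by ring) (by ring) (by ring)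

theorem mul {f g : ℝ → ℝ} {a b c d : ℝ} (hf : HasD2 f a b) (hg : HasD2 g c d) :
    HasD2 (fun t => f t * g t) (a * g 0 + f 0 * c) (b * g 0 + 2 * a * c + f 0 * d) := by
  obtain ⟨f', h1, h2, h3⟩ := hf
  obtain ⟨g', k1, k2, k3⟩ := hg
  refine ⟨fun t => f' t * g t + f t * g' t, ?_, by simp [h2, k2], ?_⟩
  · filter_upwards [h1, k1] with t ht kt using ht.mul kt
  · have := (h3.mul k1.self_of_nhds).add (h1.self_of_nhds.mul k3)
    refine this.congr_deriv ?_
    rw [h2, k2]; ring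

theorem continuousAt {f : ℝ → ℝ} {a b : ℝ} (hf : HasD2 f a b) : ContinuousAt f 0 := by
  obtain ⟨f', h1, h2, h3⟩ := hf
  exact h1.self_of_nhds.continuousAt

theorem comp {f ρ ρ' : ℝ → ℝ} {a b c : ℝ} (hf : HasD2 f a b)
    (h1 : ∀ᶠ s in 𝓝 (f 0), HasDerivAt ρ (ρ' s) s) (h2 : HasDerivAt ρ' c (f 0)) :
    HasD2 (fun t => ρ (f t)) (ρ' (f 0) * a) (ρ' (f 0) * b + c * a ^ 2) := by
  have hc := hf.continuousAt
  obtain ⟨f', k1, k2, k3⟩ := hf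
  refine ⟨fun t => ρ' (f t) * f' t, ?_, by simp [k2], ?_⟩
  · filter_upwards [k1, hc.eventually h1] with t kt ht
    exact ht.comp t kt
  · have := (h2.comp (0:ℝ) k1.self_of_nhds).mul k3
    refine this.congr_deriv ?_
    simp only [Function.comp, k2]
    ring

theorem sum {ι : Type*} (s : Finset ι) {f : ι → ℝ → ℝ} {a b : ι → ℝ}
    (h : ∀ i ∈ s, HasD2 (f i) (a i) (b i)) :
    HasD2 (fun t => ∑ i ∈ s, f i t) (∑ i ∈ s, a i) (∑ i ∈ s, b i) := by
  classical
  induction s using Finset.induction_on with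
  | empty => simpa using const 0
  | insert i s hi ih =>
    refine ((h i (Finset.mem_insert_self _ _)).add
      (ih fun j hj => h j (Finset.mem_insert_of_mem hj))).congr
      (fun t => by rw [Finset.sum_insert hi]) (by rw [Finset.sum_insert hi])
      (by rw [Finset.sum_insert hi])

theorem fst_eq_zero {f : ℝ → ℝ} {a b : ℝ} (hf : HasD2 f a b) (hm : IsLocalMax f 0) : a = 0 := by
  obtain ⟨f', h1, h2, h3⟩ := hf
  rw [← h2]
  exact hm.hasDerivAt_eq_zero h1.self_of_nhds

theorem snd_nonpos {f : ℝ → ℝ} {a b : ℝ} (hf : HasD2 f a b) (hm : IsLocalMax f 0) : b ≤ 0 := by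
  have ha := hf.fst_eq_zero hm
  have hc := hf.continuousAt
  obtain ⟨f', h1, h2, h3⟩ := hf
  by_contra hb
  push Not at hb
  have e : deriv f =ᶠ[𝓝 0] f' := by
    filter_upwards [h1] with t ht using ht.deriv
  have d2 : deriv (deriv f) 0 = b := by
    rw [e.deriv_eq]; exact h3.deriv
  have hmin : IsLocalMin f 0 := by
    apply isLocalMin_of_deriv_deriv_pos
    · rw [d2]; exact hb
    · rw [h1.self_of_nhds.deriv, h2, ha]
    · exact hc
  have hconst : f =ᶠ[𝓝 0] fun _ => f 0 := by
    filter_upwards [hm, hmin] with t h1 h2 using le_antisymm h1 h2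
  have e2 : deriv f =ᶠ[𝓝 0] fun _ => 0 := by
    have := hconst.eventuallyEq_nhds
    filter_upwards [this] with t ht
    rw [ht.deriv_eq]; simp
  have : deriv (deriv f) 0 = 0 := by
    rw [e2.deriv_eq]; simp
  linarith

end HasD2

section basics
variable {N : ℕ}

theorem isLocalMax_line {F : EuclideanSpace ℝ (Fin N) → ℝ} {x : EuclideanSpace ℝ (Fin N)}
    (hm : IsLocalMax F x) (v : EuclideanSpace ℝ (Fin N)) :
    IsLocalMax (fun t : ℝ => F (x + t • v)) 0 := by
  have hc : Tendsto (fun t : ℝ => x + t • v) (𝓝 0) (𝓝 x) := by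
    have : Continuous (fun t : ℝ => x + t • v) := by fun_prop
    simpa using this.tendsto 0
  have h2 := hc.eventually hm
  filter_upwards [h2] with t ht
  simpa using ht

theorem hasD2_of_contDiffAt {u : EuclideanSpace ℝ (Fin N) → ℝ} {x : EuclideanSpace ℝ (Fin N)}
    (hu : ContDiffAt ℝ 2 u x) (v : EuclideanSpace ℝ (Fin N)) :
    HasD2 (fun t => u (x + t • v)) (fderiv ℝ u x v) (fderiv ℝ (fderiv ℝ u) x v v) := by
  have hl : ∀ t : ℝ, HasDerivAt (fun t : ℝ => x + t • v) v t := by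
    intro t
    have := ((hasDerivAt_id t).smul_const v).const_add x
    simpa using this
  have hcont : Tendsto (fun t : ℝ => x + t • v) (𝓝 0) (𝓝 x) := by
    have := (hl 0).continuousAt.tendsto
    simpa using this
  refine ⟨fun t => fderiv ℝ u (x + t • v) v, ?_, by simp, ?_⟩
  · have : ∀ᶠ y in 𝓝 x, DifferentiableAt ℝ u y := by
      filter_upwards [hu.eventually (by simp)] with y hy
      exact hy.differentiableAt (by simp)
    filter_upwards [hcont.eventually this] with t ht
    exact ht.hasFDerivAt.comp_hasDerivAt t (hl t)
  · have h1 : DifferentiableAt ℝ (fderiv ℝ u) x :=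
      (hu.fderiv_right (m := 1) (by norm_num)).differentiableAt (by simp)
    have h2 : HasFDerivAt (fderiv ℝ u) (fderiv ℝ (fderiv ℝ u) x) (x + (0:ℝ) • v) := by
      simpa using h1.hasFDerivAt
    have h3 := h2.comp_hasDerivAt (0:ℝ) (hl 0)
    have h4 := h3.clm_apply (hasDerivAt_const (0:ℝ) v)
    simpa using h4

theorem laplacian_eq (u : EuclideanSpace ℝ (Fin N) → ℝ) (x : EuclideanSpace ℝ (Fin N)) :
    laplacian u x = ∑ i, fderiv ℝ (fderiv ℝ u) x (EuclideanSpace.single i 1)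
      (EuclideanSpace.single i 1) := by
  unfold laplacian
  refine Finset.sum_congr rfl fun i _ => ?_
  rw [iteratedFDeriv_two_apply]
  simp

theorem gradient_apply (u : EuclideanSpace ℝ (Fin N) → ℝ) (x : EuclideanSpace ℝ (Fin N))
    (v : EuclideanSpace ℝ (Fin N)) : fderiv ℝ u x v = inner ℝ (gradient u x) v := by
  unfold gradient
  rw [InnerProductSpace.toDual_symm_apply]

theorem gradient_coord (u : EuclideanSpace ℝ (Fin N) → ℝ) (x : EuclideanSpace ℝ (Fin N))
    (i : Fin N) : fderiv ℝ u x (EuclideanSpace.single i 1) = gradient u x i := by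
  rw [gradient_apply, EuclideanSpace.inner_single_right]; simp

theorem norm_sq_single (x : EuclideanSpace ℝ (Fin N)) (i : Fin N) (t : ℝ) :
    ‖x + t • EuclideanSpace.single i (1:ℝ)‖ ^ 2 = ‖x‖ ^ 2 + 2 * x i * t + 1 * t ^ 2 := by
  rw [norm_add_sq_real, inner_smul_right, EuclideanSpace.inner_single_right, norm_smul]
  simp; ring

end basics

theorem mem_halfSpace {n : ℕ} {x : EuclideanSpace ℝ (Fin (n+1))} :
    x ∈ halfSpace n ↔ 0 < x (Fin.last n) := by
  simp [halfSpace]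

theorem closure_halfSpace_eq (n : ℕ) : closure (halfSpace n) = {x | 0 ≤ x (Fin.last n)} := by
  have hc : Continuous fun x : EuclideanSpace ℝ (Fin (n+1)) => x (Fin.last n) := by fun_prop
  apply subset_antisymm
  · apply closure_minimal
    · intro x hx; simpa using (mem_halfSpace.1 hx).le
    · exact isClosed_le continuous_const hc
  · intro x hx
    have : Tendsto (fun t : ℝ => x + t • EuclideanSpace.single (Fin.last n) (1:ℝ)) (𝓝[>] 0) (𝓝 x) := by
      have h : Continuous (fun t : ℝ => x + t • EuclideanSpace.single (Fin.last n) (1:ℝ)) := by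
        fun_prop
      have := h.tendsto 0
      simp only [zero_smul, add_zero] at this
      exact this.mono_left nhdsWithin_le_nhds
    refine mem_closure_of_tendsto this ?_
    filter_upwards [self_mem_nhdsWithin] with t ht
    rw [mem_halfSpace]
    simp at ht hx ⊢; linarith

theorem isOpen_halfSpace (n : ℕ) : IsOpen (halfSpace n) := by
  have hc : Continuous fun x : EuclideanSpace ℝ (Fin (n+1)) => x (Fin.last n) := by fun_prop
  exact isOpen_lt continuous_const hc

theorem tendsto_dq {E F : Type*} [NormedAddCommGroup E] [NormedSpace ℝ E]
    [NormedAddCommGroup F] [NormedSpace ℝ F] {f : E → F} {f' : E →L[ℝ] F} {z : E}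
    (hf : HasStrictFDerivAt f f' z) {h : ℕ → ℝ} {x : ℕ → E} (h0 : ∀ j, 0 < h j)
    (hh : Tendsto h atTop (𝓝 0)) (hx : Tendsto x atTop (𝓝 z)) (v : E) :
    Tendsto (fun j => (h j)⁻¹ • (f (x j + h j • v) - f (x j))) atTop (𝓝 (f' v)) := by
  have hy : Tendsto (fun j => x j + h j • v) atTop (𝓝 z) := by
    simpa using hx.add (hh.smul_const v)
  have ho := hf.isLittleO.comp_tendsto (hy.prodMk_nhds hx)
  have ho2 : (fun j => f (x j + h j • v) - f (x j) - h j • f' v) =o[atTop] h := by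
    have h1 : (fun j => f (x j + h j • v) - f (x j) - h j • f' v) =o[atTop] 
        fun j => h j • v := by
      refine ho.congr (fun j => by simp) (fun j => by simp)
    refine h1.trans_isBigO ?_
    refine Asymptotics.IsBigO.of_bound ‖v‖ (Eventually.of_forall fun j => ?_)
    rw [norm_smul, mul_comm]
  have h2 := ho2.tendsto_inv_smul_nhds_zero
  have h3 := h2.add_const (f' v)
  rw [zero_add] at h3
  refine h3.congr fun j => ?_
  rw [smul_sub, smul_smul, inv_mul_cancel₀ (h0 j).ne', one_smul, sub_add_cancel]

/-- sum of squares of difference quotients -/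
noncomputable def dqs {N : ℕ} (u : EuclideanSpace ℝ (Fin N) → ℝ) (h : ℝ)
    (x : EuclideanSpace ℝ (Fin N)) : ℝ :=
  ∑ i, (h⁻¹ * (u (x + h • EuclideanSpace.single i 1) - u x)) ^ 2

theorem bern_limit {N : ℕ} {p : ℝ} (hp1 : 1 < p) {u φ : EuclideanSpace ℝ (Fin N) → ℝ}
    {Ω : Set (EuclideanSpace ℝ (Fin N))} (hΩ : IsOpen Ω) (hu : ContDiffOn ℝ 2 u Ω)
    (heq : ∀ x ∈ Ω, -laplacian u x = ‖gradient u x‖ ^ p)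
    {z : EuclideanSpace ℝ (Fin N)} (hz : z ∈ Ω)
    {G L : Fin N → EuclideanSpace ℝ (Fin N) → ℝ}
    (hφ : ∀ᶠ y in 𝓝 z, ∀ i, HasD2 (fun t => φ (y + t • EuclideanSpace.single i 1)) (G i y) (L i y))
    (hG : ∀ i, ContinuousAt (G i) z) (hL : ∀ i, ContinuousAt (L i) z)
    {h : ℕ → ℝ} {x : ℕ → EuclideanSpace ℝ (Fin N)} (h0 : ∀ j, 0 < h j)
    (hh : Tendsto h atTop (𝓝 0)) (hx : Tendsto x atTop (𝓝 z))
    (hmax : ∀ᶠ j in atTop, IsLocalMax (fun y => dqs u (h j) y - φ y) (x j)) :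
    2 / N * ‖gradient u z‖ ^ (2 * p) ≤ ∑ i, L i z +
      p * ‖gradient u z‖ ^ (p - 2) * ∑ i, gradient u z i * G i z := by
  have huz : ContDiffAt ℝ 2 u z := hu.contDiffAt (hΩ.mem_nhds hz)
  set e : Fin N → EuclideanSpace ℝ (Fin N) := fun i => EuclideanSpace.single i 1 with he
  set D : Fin N → Fin N → ℝ := fun i j => fderiv ℝ (fderiv ℝ u) z (e i) (e j) with hD
  -- strict derivatives
  have s1 : HasStrictFDerivAt u (fderiv ℝ u z) z := huz.hasStrictFDerivAt (by simp)
  have c1 : ContDiffAt ℝ 1 (fderiv ℝ u) z := huz.fderiv_right (m := 1) (by norm_num)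
  have s2 : HasStrictFDerivAt (fderiv ℝ u) (fderiv ℝ (fderiv ℝ u) z) z :=
    c1.hasStrictFDerivAt (by simp)
  set T : (EuclideanSpace ℝ (Fin N) →L[ℝ] ℝ) →L[ℝ] EuclideanSpace ℝ (Fin N) :=
    ∑ k, (ContinuousLinearMap.apply ℝ ℝ (e k)).smulRight (e k) with hT
  have hTA : ∀ A m, T A m = A (e m) := by
    intro A m
    simp [hT, he, Finset.sum_apply, Pi.single_apply]
  have hgT : gradient u = fun y => T (fderiv ℝ u y) := by
    ext y m
    rw [hTA, gradient_coord]
  have c2 : ContDiffAt ℝ 1 (gradient u) z := by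
    rw [hgT]
    exact T.contDiff.contDiffAt.comp z c1
  have gd : HasFDerivAt (gradient u) (T.comp (fderiv ℝ (fderiv ℝ u) z)) z := by
    rw [hgT]
    exact T.hasFDerivAt.comp z s2.hasFDerivAt
  have c3 : ContDiffAt ℝ 1 (fun y => ‖gradient u y‖ ^ p) z :=
    (contDiff_norm_rpow hp1).contDiffAt.comp z c2
  have gd3 := (hasFDerivAt_norm_rpow (gradient u z) hp1).comp z gd
  have s3 : HasStrictFDerivAt (fun y => ‖gradient u y‖ ^ p) _ z :=
    c3.hasStrictFDerivAt' gd3 (by simp)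
  -- limits
  have l1 : ∀ i, Tendsto (fun j => (h j)⁻¹ * (u (x j + h j • e i) - u (x j))) atTop
      (𝓝 (gradient u z i)) := by
    intro i
    have := tendsto_dq s1 h0 hh hx (e i)
    rw [gradient_coord] at this
    exact this
  have l2 : ∀ i k, Tendsto (fun j => (h j)⁻¹ * (fderiv ℝ u (x j + h j • e i) (e k) 
      - fderiv ℝ u (x j) (e k))) atTop (𝓝 (D i k)) := by
    intro i k
    have := tendsto_dq s2 h0 hh hx (e i)
    have := ((ContinuousLinearMap.apply ℝ ℝ (e k)).continuous.tendsto _).comp this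
    exact this
  have l3 : ∀ i, Tendsto (fun j => (h j)⁻¹ * (‖gradient u (x j + h j • e i)‖ ^ p
      - ‖gradient u (x j)‖ ^ p)) atTop
      (𝓝 (p * ‖gradient u z‖ ^ (p - 2) * ∑ k, gradient u z k * D i k)) := by
    intro i
    have := tendsto_dq s3 h0 hh hx (e i)
    convert! this using 2
    simp only [ContinuousLinearMap.comp_apply, smul_apply, innerSL_apply_apply,
      smul_eq_mul]
    congr 1
    rw [PiLp.inner_apply]
    refine Finset.sum_congr rfl fun k _ => ?_
    rw [hTA]
    simp [hD, mul_comm]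
  -- eventual inequalities
  have hy : ∀ i, Tendsto (fun j => x j + h j • e i) atTop (𝓝 z) := fun i => by
    simpa using hx.add (hh.smul_const (e i))
  have evΩ : ∀ᶠ y in 𝓝 z, y ∈ Ω := hΩ.mem_nhds hz
  have ev : ∀ᶠ j in atTop, 
      (∀ k, 2 * ∑ i, ((h j)⁻¹ * (u (x j + h j • e i) - u (x j))) * 
        ((h j)⁻¹ * (fderiv ℝ u (x j + h j • e i) (e k) - fderiv ℝ u (x j) (e k))) = G k (x j)) ∧
      2 * (∑ i, ∑ k, ((h j)⁻¹ * (fderiv ℝ u (x j + h j • e i) (e k) - fderiv ℝ u (x j) (e k))) ^ 2) -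
      2 * ∑ i, ((h j)⁻¹ * (u (x j + h j • e i) - u (x j))) * ((h j)⁻¹ * (‖gradient u (x j + h j • e i)‖ ^ p
      - ‖gradient u (x j)‖ ^ p)) ≤ ∑ k, L k (x j) := by
    filter_upwards [hmax, hx.eventually hφ, hx.eventually evΩ, 
      eventually_all.2 fun i => (hy i).eventually evΩ] with j hm hφj hxj hyj
    have hd : ∀ k, HasD2 (fun t => dqs u (h j) (x j + t • e k) - φ (x j + t • e k)) 
      (∑ i, 2 * (((h j)⁻¹ * (u (x j + h j • e i) - u (x j))) * 
        ((h j)⁻¹ * (fderiv ℝ u (x j + h j • e i) (e k) - fderiv ℝ u (x j) (e k)))) - G k (x j))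
      (∑ i, (2 * ((h j)⁻¹ * (fderiv ℝ u (x j + h j • e i) (e k) - fderiv ℝ u (x j) (e k))) ^ 2 +
        2 * ((h j)⁻¹ * (u (x j + h j • e i) - u (x j))) * ((h j)⁻¹ * 
          (fderiv ℝ (fderiv ℝ u) (x j + h j • e i) (e k) (e k) -
            fderiv ℝ (fderiv ℝ u) (x j) (e k) (e k)))) - L k (x j)) := by
      intro k
      refine HasD2.sub ?_ (hφj k)
      unfold dqs
      refine HasD2.sum _ fun i _ => ?_
      have a1 := hasD2_of_contDiffAt (hu.contDiffAt (hΩ.mem_nhds hxj)) (e k)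
      have a2 := hasD2_of_contDiffAt (hu.contDiffAt (hΩ.mem_nhds (hyj i))) (e k)
      have a3 := (a2.sub a1).const_mul (h j)⁻¹
      refine (a3.mul a3).congr (fun t => ?_) ?_ ?_
      · rw [pow_two, add_right_comm]
      · simp only [zero_smul, add_zero]; ring
      · simp only [zero_smul, add_zero]; ring
    have hloc : ∀ k, IsLocalMax (fun t : ℝ => dqs u (h j) (x j + t • e k) - φ (x j + t • e k)) 0 := by
      intro k
      exact isLocalMax_line hm (e k)
    constructor
    · intro k
      have := (hd k).fst_eq_zero (hloc k)
      rw [Finset.mul_sum]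
      linarith
    · have hsum : ∑ k, (∑ i, (2 * ((h j)⁻¹ * (fderiv ℝ u (x j + h j • e i) (e k) - fderiv ℝ u (x j) (e k))) ^ 2 +
        2 * ((h j)⁻¹ * (u (x j + h j • e i) - u (x j))) * ((h j)⁻¹ * 
          (fderiv ℝ (fderiv ℝ u) (x j + h j • e i) (e k) (e k) -
            fderiv ℝ (fderiv ℝ u) (x j) (e k) (e k)))) - L k (x j)) ≤ 0 :=
        Finset.sum_nonpos fun k _ => (hd k).snd_nonpos (hloc k)
      rw [Finset.sum_sub_distrib, Finset.sum_comm] at hsum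
      have hp : ∀ i, -(‖gradient u (x j + h j • e i)‖ ^ p - ‖gradient u (x j)‖ ^ p) = 
          ∑ k, (fderiv ℝ (fderiv ℝ u) (x j + h j • e i) (e k) (e k) -
            fderiv ℝ (fderiv ℝ u) (x j) (e k) (e k)) := by
        intro i
        rw [← heq _ (hyj i), ← heq _ hxj, laplacian_eq, laplacian_eq, Finset.sum_sub_distrib]
        ring
      have hs2 : ∀ i, ∑ k, (2 * ((h j)⁻¹ * (fderiv ℝ u (x j + h j • e i) (e k) - fderiv ℝ u (x j) (e k))) ^ 2 +
        2 * ((h j)⁻¹ * (u (x j + h j • e i) - u (x j))) * ((h j)⁻¹ * 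
          (fderiv ℝ (fderiv ℝ u) (x j + h j • e i) (e k) (e k) -
            fderiv ℝ (fderiv ℝ u) (x j) (e k) (e k)))) = 
          2 * ∑ k, ((h j)⁻¹ * (fderiv ℝ u (x j + h j • e i) (e k) - fderiv ℝ u (x j) (e k))) ^ 2 -
          2 * (((h j)⁻¹ * (u (x j + h j • e i) - u (x j))) * ((h j)⁻¹ * (‖gradient u (x j + h j • e i)‖ ^ p
      - ‖gradient u (x j)‖ ^ p))) := by
        intro i
        rw [Finset.sum_add_distrib, ← Finset.mul_sum, ← Finset.mul_sum, ← Finset.mul_sum, ← hp i]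
        ring
      rw [Finset.sum_congr rfl fun i _ => hs2 i, Finset.sum_sub_distrib, ← Finset.mul_sum, ← Finset.mul_sum] at hsum
      linarith
  -- pass to the limit
  have hGz : ∀ k, 2 * ∑ i, gradient u z i * D i k = G k z := by
    intro k
    have t1 : Tendsto (fun j => 2 * ∑ i, ((h j)⁻¹ * (u (x j + h j • e i) - u (x j))) * 
        ((h j)⁻¹ * (fderiv ℝ u (x j + h j • e i) (e k) - fderiv ℝ u (x j) (e k)))) atTop
        (𝓝 (2 * ∑ i, gradient u z i * D i k)) :=
      (tendsto_finsetSum _ fun i _ => (l1 i).mul (l2 i k)).const_mul 2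
    have t2 : Tendsto (fun j => G k (x j)) atTop (𝓝 (G k z)) := (hG k).tendsto.comp hx
    refine tendsto_nhds_unique (t1.congr' ?_) t2
    filter_upwards [ev] with j hj using hj.1 k
  have hLz : 2 * (∑ i, ∑ k, D i k ^ 2) - 2 * ∑ i, gradient u z i * 
      (p * ‖gradient u z‖ ^ (p - 2) * ∑ k, gradient u z k * D i k) ≤ ∑ k, L k z := by
    have t1 := ((tendsto_finsetSum Finset.univ fun i _ => 
      tendsto_finsetSum Finset.univ fun k _ => (l2 i k).pow 2).const_mul 2).sub
      ((tendsto_finsetSum Finset.univ fun i _ => (l1 i).mul (l3 i)).const_mul 2)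
    have t2 : Tendsto (fun j => ∑ k, L k (x j)) atTop (𝓝 (∑ k, L k z)) := 
      tendsto_finsetSum _ fun k _ => (hL k).tendsto.comp hx
    refine le_of_tendsto_of_tendsto t1 t2 ?_
    filter_upwards [ev] with j hj using hj.2
  have hcross : 2 * ∑ i, gradient u z i * 
      (p * ‖gradient u z‖ ^ (p - 2) * ∑ k, gradient u z k * D i k) = 
      p * ‖gradient u z‖ ^ (p - 2) * ∑ k, gradient u z k * G k z := by
    simp only [← hGz, Finset.mul_sum]
    rw [Finset.sum_comm]
    refine Finset.sum_congr rfl fun k _ => Finset.sum_congr rfl fun i _ => ?_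
    ring
  have hlap : ∑ i, D i i = - ‖gradient u z‖ ^ p := by
    rw [← heq z hz, laplacian_eq]; ring
  have hcs : (∑ i, D i i) ^ 2 ≤ N * ∑ i, D i i ^ 2 := by
    simpa using sq_sum_le_card_mul_sum_sq (s := Finset.univ) (f := fun i => D i i)
  have hdiag : ∑ i, D i i ^ 2 ≤ ∑ i, ∑ k, D i k ^ 2 := 
    Finset.sum_le_sum fun i _ => Finset.single_le_sum (f := fun k => D i k ^ 2) 
      (fun k _ => sq_nonneg _) (Finset.mem_univ i)
  have hpow : ‖gradient u z‖ ^ (2 * p) = (‖gradient u z‖ ^ p) ^ 2 := by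
    rw [← Real.rpow_natCast, ← Real.rpow_mul (norm_nonneg _)]; congr 1; push_cast; ring
  have hfin : 1 / N * ‖gradient u z‖ ^ (2 * p) ≤ ∑ i, ∑ k, D i k ^ 2 := by
    rw [hpow]
    rw [hlap, neg_sq] at hcs
    refine le_trans ?_ hdiag
    rcases Nat.eq_zero_or_pos N with rfl | hN
    · simp
    · have : (0:ℝ) < N := by exact_mod_cast hN
      rw [one_div, inv_mul_le_iff₀ this]; exact hcs
  have : 2 / (N:ℝ) * ‖gradient u z‖ ^ (2 * p) = 2 * (1 / N * ‖gradient u z‖ ^ (2 * p)) := by ring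
  rw [this]
  linarith

/-- final algebra in the Bernstein argument -/
theorem bern_algebra {N p q K Y d R S T φ : ℝ} (hN : 0 < N) (hp1 : 1 < p) (hq : q = 1 / (p - 1))
    (hK : K = N * (4 * q * N + 8 * q * (2 * q + 1) + 4 * p * q) + 1) (hR : 0 < R) (hd : 0 < d)
    (hdR : d ≤ R ^ 2) (hY0 : 0 ≤ Y) (hφ : φ = (K * R / d) ^ (2 * q)) (hφY : φ < Y ^ 2)
    (hT : |T| ≤ Y * R) (hS : S ≤ R ^ 2)
    (h : 2 / N * Y ^ (2 * p) ≤ (4 * q * N * φ / d + 8 * q * (2 * q + 1) * φ * S / d ^ 2)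
      + p * Y ^ (p - 2) * (4 * q * φ / d * T)) : False := by
  have hq0 : 0 < q := by rw [hq]; apply div_pos one_pos; linarith
  have hK1 : 1 ≤ K := by
    rw [hK]; have : 0 ≤ N * (4 * q * N + 8 * q * (2 * q + 1) + 4 * p * q) := by positivity
    linarith
  have hB : 0 < K * R / d := by positivity
  have hφ0 : 0 < φ := by rw [hφ]; positivity
  have hY : 0 < Y := by
    rcases hY0.eq_or_lt with h0 | h0
    · rw [← h0] at hφY; norm_num at hφY; linarith
    · exact h0
  set X := Y ^ (p - 1) with hX
  have hX0 : 0 < X := by positivity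
  have hBX : K * R / d < X := by
    have h1 : φ ^ ((p - 1) / 2) < (Y ^ 2) ^ ((p - 1) / 2) :=
      Real.rpow_lt_rpow hφ0.le hφY (by linarith)
    rw [hφ, ← Real.rpow_mul hB.le] at h1
    have e1 : 2 * q * ((p - 1) / 2) = 1 := by rw [hq]; field_simp [show p - 1 ≠ 0 by linarith]
    rw [e1, Real.rpow_one, ← Real.rpow_natCast Y 2, ← Real.rpow_mul hY0] at h1
    have e2 : ((2:ℕ):ℝ) * ((p - 1) / 2) = p - 1 := by push_cast; ring
    rw [e2] at h1
    exact h1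
  set a := R / d with ha
  have ha0 : 0 < a := by positivity
  have haX : K * a < X := by rw [ha, ← mul_div_assoc]; exact hBX
  have eY : Y ^ (2 * p) = Y ^ 2 * X ^ 2 := by
    rw [hX, ← Real.rpow_natCast Y 2, ← Real.rpow_natCast _ 2, ← Real.rpow_mul hY0, ← Real.rpow_add hY]
    congr 1; push_cast; ring
  have eY2 : Y ^ (p - 2) * Y = X := by
    rw [hX]; nth_rw 2 [← Real.rpow_one Y]; rw [← Real.rpow_add hY]; congr 1; ring
  -- bounds
  have b1 : 4 * q * N * φ / d ≤ 4 * q * N * (Y ^ 2 * a ^ 2) := by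
    have : φ / d ≤ Y ^ 2 * a ^ 2 := by
      have h1 : 1 / d ≤ a ^ 2 := by
        rw [ha, div_pow, div_le_div_iff₀ hd (by positivity)]; nlinarith
      calc φ / d = φ * (1 / d) := by ring
        _ ≤ Y ^ 2 * a ^ 2 := mul_le_mul hφY.le h1 (by positivity) (by positivity)
    calc 4 * q * N * φ / d = 4 * q * N * (φ / d) := by ring
      _ ≤ _ := mul_le_mul_of_nonneg_left this (by positivity)
  have b2 : 8 * q * (2 * q + 1) * φ * S / d ^ 2 ≤ 8 * q * (2 * q + 1) * (Y ^ 2 * a ^ 2) := by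
    have : φ * (S / d ^ 2) ≤ Y ^ 2 * a ^ 2 := by
      have h1 : S / d ^ 2 ≤ a ^ 2 := by
        rw [ha, div_pow]; gcongr
      calc φ * (S / d ^ 2) ≤ φ * a ^ 2 := mul_le_mul_of_nonneg_left h1 hφ0.le
        _ ≤ _ := mul_le_mul_of_nonneg_right hφY.le (by positivity)
    calc 8 * q * (2 * q + 1) * φ * S / d ^ 2 = 8 * q * (2 * q + 1) * (φ * (S / d ^ 2)) := by ring
      _ ≤ _ := mul_le_mul_of_nonneg_left this (by positivity)
  have b3 : p * Y ^ (p - 2) * (4 * q * φ / d * T) ≤ 4 * p * q * (X * Y ^ 2 * a) := by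
    have h1 : T ≤ Y * R := (le_abs_self T).trans hT
    calc p * Y ^ (p - 2) * (4 * q * φ / d * T) ≤ p * Y ^ (p - 2) * (4 * q * φ / d * (Y * R)) := by
          gcongr
      _ = 4 * p * q * (Y ^ (p - 2) * Y) * φ * a := by rw [ha]; ring
      _ = 4 * p * q * X * a * φ := by rw [eY2]; ring
      _ ≤ 4 * p * q * X * a * Y ^ 2 := by gcongr
      _ = _ := by ring
  have hKa : a ≤ X / K := by rw [le_div_iff₀ (by linarith)]; linarith
  have hKa2 : a ^ 2 ≤ X ^ 2 / K := by
    calc a ^ 2 ≤ (X / K) ^ 2 := by gcongr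
      _ = X ^ 2 / K / K := by ring
      _ ≤ X ^ 2 / K / 1 := by gcongr
      _ = _ := by ring
  have tot : 2 / N * (Y ^ 2 * X ^ 2) ≤ (4 * q * N + 8 * q * (2 * q + 1) + 4 * p * q) / K * (Y ^ 2 * X ^ 2) := by
    rw [← eY]
    refine h.trans ?_
    calc _ ≤ 4 * q * N * (Y ^ 2 * a ^ 2) + 8 * q * (2 * q + 1) * (Y ^ 2 * a ^ 2) + 4 * p * q * (X * Y ^ 2 * a) := by linarith
      _ ≤ 4 * q * N * (Y ^ 2 * (X ^ 2 / K)) + 8 * q * (2 * q + 1) * (Y ^ 2 * (X ^ 2 / K)) + 4 * p * q * (X * Y ^ 2 * (X / K)) := by gcongr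
      _ = _ := by rw [eY]; ring
  have hpos : 0 < Y ^ 2 * X ^ 2 := by positivity
  have := le_of_mul_le_mul_right tot hpos
  rw [div_le_div_iff₀ hN (by linarith)] at this
  have hM : 0 ≤ N * (4 * q * N + 8 * q * (2 * q + 1) + 4 * p * q) := by positivity
  nlinarith

theorem bernstein_grad {N : ℕ} (hN : 0 < N) {p : ℝ} (hp1 : 1 < p) : ∃ K : ℝ, 0 < K ∧
    ∀ (u : EuclideanSpace ℝ (Fin N) → ℝ) (Ω : Set (EuclideanSpace ℝ (Fin N))), IsOpen Ω →
    ContDiffOn ℝ 2 u Ω → (∀ x ∈ Ω, -laplacian u x = ‖gradient u x‖ ^ p) →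
    ∀ (c : EuclideanSpace ℝ (Fin N)) (R : ℝ), 0 < R → Metric.closedBall c R ⊆ Ω →
    ‖gradient u c‖ ≤ (K / R) ^ (1 / (p - 1)) := by
  set q := 1 / (p - 1) with hq
  have hq0 : 0 < q := by rw [hq]; apply div_pos one_pos; linarith
  have hN' : (0:ℝ) < N := by exact_mod_cast hN
  set K : ℝ := N * (4 * q * N + 8 * q * (2 * q + 1) + 4 * p * q) + 1 with hK
  have hK0 : 0 < K := by positivity
  refine ⟨K, hK0, ?_⟩
  intro u Ω hΩ hu heq c R hR hball
  by_contra hcon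
  push Not at hcon
  set B := K * R with hB
  have hB0 : 0 < B := by positivity
  set d : EuclideanSpace ℝ (Fin N) → ℝ := fun y => R ^ 2 - ‖y - c‖ ^ 2 with hd
  have hdc : Continuous d := by rw [hd]; fun_prop
  set φ : EuclideanSpace ℝ (Fin N) → ℝ := fun y => B ^ (2 * q) * (d y) ^ (-(2 * q)) with hφ
  have φeq : ∀ y, 0 < d y → φ y = (B / d y) ^ (2 * q) := by
    intro y hy
    simp only [hφ]
    rw [Real.div_rpow hB0.le hy.le, Real.rpow_neg hy.le]; rfl
  set w : EuclideanSpace ℝ (Fin N) → ℝ := fun y => ‖gradient u y‖ ^ 2 with hw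
  -- continuity of w
  have hgc : ContinuousOn (gradient u) Ω := by
    have : ContinuousOn (fderiv ℝ u) Ω := hu.continuousOn_fderiv_of_isOpen hΩ (by norm_num)
    unfold gradient
    exact (InnerProductSpace.toDual ℝ (EuclideanSpace ℝ (Fin N))).symm.continuous.comp_continuousOn this
  have hwc : ContinuousOn w Ω := hgc.norm.pow 2
  obtain ⟨M0, hM0⟩ := (isCompact_closedBall c R).bddAbove_image (hwc.mono hball)
  have hM : ∀ y ∈ Metric.closedBall c R, w y ≤ M0 := fun y hy => hM0 ⟨y, hy, rfl⟩
  have hM00 : 0 ≤ M0 := le_trans (sq_nonneg _) (hM c (by simp [hR.le]))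
  obtain ⟨τ, hτ0, hτR, hτφ⟩ : ∃ τ, 0 < τ ∧ τ ≤ R ^ 2 ∧ M0 < (B / τ) ^ (2 * q) := by
    refine ⟨min (R ^ 2) (B / (M0 + 1) ^ (1 / (2 * q))), by positivity, min_le_left _ _, ?_⟩
    have hle : (M0 + 1) ^ (1 / (2 * q)) ≤ B / min (R ^ 2) (B / (M0 + 1) ^ (1 / (2 * q))) := by
      rw [le_div_iff₀ (by positivity)]
      calc _ ≤ (M0 + 1) ^ (1 / (2 * q)) * (B / (M0 + 1) ^ (1 / (2 * q))) := by
            gcongr; exact min_le_right _ _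
        _ = B := by field_simp
    have h2 := Real.rpow_le_rpow (by positivity) hle (show 0 ≤ 2 * q by positivity)
    rw [← Real.rpow_mul (by positivity), one_div_mul_cancel (by positivity), Real.rpow_one] at h2
    linarith
  set S : Set (EuclideanSpace ℝ (Fin N)) := {y | τ ≤ d y} with hS
  have memS : ∀ y, y ∈ S ↔ τ ≤ d y := fun y => by simp [hS]
  have hSb : ∀ y ∈ S, ‖y - c‖ ≤ R - τ / (2 * R) := by
    intro y hy
    rw [memS] at hy
    simp only [hd] at hy
    have h1 : τ / (2 * R) ≤ R / 2 := by
      rw [div_le_div_iff₀ (by positivity) (by norm_num)]; nlinarith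
    apply abs_le_of_sq_le_sq' _ (by linarith) |>.2
    have : (R - τ / (2 * R)) ^ 2 = R ^ 2 - τ + (τ / (2 * R)) ^ 2 := by field_simp; ring
    rw [this]; nlinarith [sq_nonneg (τ / (2 * R))]
  have hSball : S ⊆ Metric.closedBall c R := by
    intro y hy
    rw [Metric.mem_closedBall, dist_eq_norm]
    have := hSb y hy
    have : 0 < τ / (2 * R) := by positivity
    linarith
  have hScomp : IsCompact S := by
    refine (isCompact_closedBall c R).of_isClosed_subset ?_ hSball
    exact isClosed_le continuous_const hdc
  have hcS : c ∈ S := by rw [memS]; simp [hd, hτR]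
  set δ := τ / (2 * R) with hδ
  have hδ0 : 0 < δ := by positivity
  set h : ℕ → ℝ := fun j => δ * (1 / ((j:ℝ) + 1)) with hh
  have h0 : ∀ j, 0 < h j := fun j => by simp only [hh]; positivity
  have hle : ∀ j, h j ≤ δ := fun j => by
    simp only [hh]
    have : 1 / ((j:ℝ) + 1) ≤ 1 := by rw [div_le_one (by positivity)]; linarith [Nat.cast_nonneg (α := ℝ) j]
    nlinarith
  have hlim : Tendsto h atTop (𝓝 0) := by
    have := (tendsto_one_div_add_atTop_nhds_zero_nat (𝕜 := ℝ)).const_mul δ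
    rw [mul_zero] at this
    exact this
  have hshift : ∀ j, ∀ i, ∀ y ∈ S, y + h j • EuclideanSpace.single i (1:ℝ) ∈ Ω := by
    intro j i y hy
    apply hball
    rw [Metric.mem_closedBall, dist_eq_norm]
    calc ‖y + h j • EuclideanSpace.single i (1:ℝ) - c‖ = ‖(y - c) + h j • EuclideanSpace.single i (1:ℝ)‖ := by
          congr 1; abel
      _ ≤ ‖y - c‖ + ‖h j • EuclideanSpace.single i (1:ℝ)‖ := norm_add_le _ _
      _ ≤ (R - δ) + δ := by
          refine add_le_add (hSb y hy) ?_
          rw [norm_smul, Real.norm_of_nonneg (h0 j).le]; simpa using hle j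
      _ = R := by ring
  have hφc : ContinuousOn φ S := by
    intro y hy
    rw [memS] at hy
    have : d y ≠ 0 := by linarith
    exact (continuousAt_const.mul (hdc.continuousAt.rpow_const (Or.inl this))).continuousWithinAt
  have hdqc : ∀ j, ContinuousOn (dqs u (h j)) S := by
    intro j
    unfold dqs
    refine continuousOn_finsetSum _ fun i _ => ?_
    refine ContinuousOn.pow (ContinuousOn.mul continuousOn_const (ContinuousOn.sub ?_ (hu.continuousOn.mono (hSball.trans hball)))) 2
    exact hu.continuousOn.comp (by fun_prop) (fun y hy => hshift j i y hy)
  have hex : ∀ j, ∃ y ∈ S, IsMaxOn (fun y => dqs u (h j) y - φ y) S y := fun j =>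
    hScomp.exists_isMaxOn ⟨c, hcS⟩ ((hdqc j).sub hφc)
  choose y hyS hymax using hex
  obtain ⟨z, hzS, ψ, hψ, hyz⟩ := hScomp.tendsto_subseq hyS
  have hzΩ : z ∈ Ω := hball (hSball hzS)
  have hlimψ : Tendsto (fun j => h (ψ j)) atTop (𝓝 0) := hlim.comp hψ.tendsto_atTop
  -- dqs converges to w
  have hdqs : ∀ (x : ℕ → EuclideanSpace ℝ (Fin N)) (x0 : EuclideanSpace ℝ (Fin N)), x0 ∈ Ω → Tendsto x atTop (𝓝 x0) →
      Tendsto (fun j => dqs u (h (ψ j)) (x j)) atTop (𝓝 (w x0)) := by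
    intro x x0 hx0 hx
    have hux : ContDiffAt ℝ 2 u x0 := hu.contDiffAt (hΩ.mem_nhds hx0)
    have s1 : HasStrictFDerivAt u (fderiv ℝ u x0) x0 := hux.hasStrictFDerivAt (by simp)
    have hw2 : w x0 = ∑ i, (gradient u x0 i) ^ 2 := by
      simp only [hw]
      rw [EuclideanSpace.norm_sq_eq]; simp
    rw [hw2]
    unfold dqs
    refine tendsto_finsetSum _ fun i _ => ?_
    have := tendsto_dq s1 (fun j => h0 (ψ j)) hlimψ hx (EuclideanSpace.single i 1)
    rw [gradient_coord] at this
    exact this.pow 2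
  have hφz : Tendsto (fun j => φ (y (ψ j))) atTop (𝓝 (φ z)) := by
    have hz' := (memS z).1 hzS
    have hne : d z ≠ 0 := by linarith
    have : ContinuousAt φ z := continuousAt_const.mul (hdc.continuousAt.rpow_const (Or.inl hne))
    exact this.tendsto.comp hyz
  have hκ : φ c < w c := by
    have hdcc : d c = R ^ 2 := by simp [hd]
    rw [φeq c (by rw [hdcc]; positivity), hdcc]
    have : B / R ^ 2 = K / R := by rw [hB]; field_simp
    rw [this, mul_comm 2 q, Real.rpow_mul (by positivity)]
    simp only [hw]
    have e2 : ((K / R) ^ q) ^ (2:ℝ) = ((K / R) ^ q) ^ 2 := by exact_mod_cast Real.rpow_natCast _ 2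
    rw [e2]
    have : 0 ≤ (K / R) ^ q := by positivity
    gcongr
  have hzmax : w c - φ c ≤ w z - φ z := by
    refine le_of_tendsto_of_tendsto ((hdqs (fun _ => c) c (hball (hSball hcS)) tendsto_const_nhds).sub_const (φ c))
      ((hdqs _ z hzΩ hyz).sub hφz) (Eventually.of_forall fun j => ?_)
    exact hymax (ψ j) hcS
  have hzφ : φ z < w z := by linarith
  have hdz : τ < d z := by
    rcases ((memS z).1 hzS).lt_or_eq with h1 | h1
    · exact h1
    · exfalso
      have := hM z (hSball hzS)
      rw [φeq z (by linarith), ← h1] at hzφ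
      linarith
  have hnear : ∀ᶠ x in 𝓝 z, τ < d x := hdc.continuousAt.eventually (lt_mem_nhds hdz)
  have hmaxev : ∀ᶠ j in atTop, IsLocalMax (fun x => dqs u (h (ψ j)) x - φ x) (y (ψ j)) := by
    filter_upwards [hyz.eventually hnear] with j hj
    refine (hymax (ψ j)).isLocalMax ?_
    have : {x | τ < d x} ∈ 𝓝 (y (ψ j)) := (isOpen_lt continuous_const hdc).mem_nhds hj
    filter_upwards [this] with x hx
    exact (memS x).2 (le_of_lt (by simpa using hx))
  -- derivatives of φ
  have hφD : ∀ᶠ x in 𝓝 z, ∀ i, HasD2 (fun t => φ (x + t • EuclideanSpace.single i 1))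
      ((B ^ (2 * q) * (-(2 * q) * (d x) ^ (-(2 * q) - 1))) * (-2 * (x - c) i))
      ((B ^ (2 * q) * (-(2 * q) * (d x) ^ (-(2 * q) - 1))) * (2 * (-1)) +
        (B ^ (2 * q) * (-(2 * q) * ((-(2 * q) - 1) * (d x) ^ (-(2 * q) - 1 - 1)))) * (-2 * (x - c) i) ^ 2) := by
    filter_upwards [hnear] with x hx i
    have hdx : 0 < d x := hτ0.trans hx
    have hdl : ∀ t : ℝ, d (x + t • EuclideanSpace.single i (1:ℝ)) = d x + (-2 * (x - c) i) * t + (-1) * t ^ 2 := by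
      intro t
      simp only [hd]
      rw [add_sub_right_comm, norm_sq_single]; ring
    have hquad := HasD2.quad (d x) (-2 * (x - c) i) (-1)
    have hc := hquad.comp (ρ := fun s => B ^ (2 * q) * s ^ (-(2 * q)))
      (ρ' := fun s => B ^ (2 * q) * (-(2 * q) * s ^ (-(2 * q) - 1)))
      (c := B ^ (2 * q) * (-(2 * q) * ((-(2 * q) - 1) * (d x) ^ (-(2 * q) - 1 - 1)))) ?_ ?_
    · refine hc.congr (fun t => ?_) ?_ ?_
      · simp only [hφ]; rw [hdl]
      · simp
      · simp
    · have : ∀ᶠ s in 𝓝 (d x), 0 < s := lt_mem_nhds hdx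
      simp only [mul_zero, add_zero, ne_eq, OfNat.ofNat_ne_zero, not_false_eq_true, zero_pow]
      filter_upwards [this] with s hs
      exact (Real.hasDerivAt_rpow_const (Or.inl hs.ne')).const_mul _
    · simp only [mul_zero, add_zero, ne_eq, OfNat.ofNat_ne_zero, not_false_eq_true, zero_pow]
      exact ((Real.hasDerivAt_rpow_const (Or.inl hdx.ne')).const_mul _).const_mul _
  have hdz0 : 0 < d z := hτ0.trans hdz
  have hci : ∀ i, Continuous fun x : EuclideanSpace ℝ (Fin N) => (x - c) i := fun i => by fun_prop
  have hcr : ∀ r : ℝ, ContinuousAt (fun x => (d x) ^ r) z := fun r =>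
    hdc.continuousAt.rpow_const (Or.inl hdz0.ne')
  have key := bern_limit hp1 hΩ hu heq hzΩ hφD
    (fun i => by
      exact (continuousAt_const.mul (continuousAt_const.mul (hcr _))).mul (continuousAt_const.mul (hci i).continuousAt))
    (fun i => by
      exact ((continuousAt_const.mul (continuousAt_const.mul (hcr _))).mul continuousAt_const).add
        ((continuousAt_const.mul (continuousAt_const.mul (continuousAt_const.mul (hcr _)))).mul
          ((continuousAt_const.mul (hci i).continuousAt).pow 2)))
    (fun j => h0 (ψ j)) hlimψ hyz hmaxev
  have er1 : (d z) ^ (-(2 * q) - 1) = (d z) ^ (-(2 * q)) / d z := by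
    rw [Real.rpow_sub hdz0, Real.rpow_one]
  have er2 : (d z) ^ (-(2 * q) - 1 - 1) = (d z) ^ (-(2 * q)) / d z / d z := by
    rw [Real.rpow_sub hdz0, er1, Real.rpow_one]
  rw [er1, er2, Finset.sum_add_distrib, ← Finset.mul_sum, ← Finset.mul_sum, ← Finset.mul_sum] at key
  have hnsq : ∑ i, (-2 * (z - c) i) ^ 2 = 4 * ‖z - c‖ ^ 2 := by
    rw [EuclideanSpace.norm_sq_eq, Finset.mul_sum]
    refine Finset.sum_congr rfl fun i _ => ?_
    rw [Real.norm_eq_abs, sq_abs]; ring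
  have hin : ∑ i, gradient u z i * (B ^ (2 * q) * (-(2 * q) * ((d z) ^ (-(2 * q)) / d z)) * (-2 * (z - c) i)) =
      4 * q * φ z / d z * inner ℝ (z - c) (gradient u z) := by
    rw [PiLp.inner_apply, Finset.mul_sum]
    refine Finset.sum_congr rfl fun i _ => ?_
    simp [hφ]; ring
  rw [hin, hnsq] at key
  simp only [Finset.sum_const, Finset.card_univ, Fintype.card_fin, nsmul_eq_mul] at key
  have hzR : ‖z - c‖ ≤ R := by
    have := hSball hzS
    rwa [Metric.mem_closedBall, dist_eq_norm] at this
  refine bern_algebra (S := ‖z - c‖ ^ 2) (T := inner ℝ (z - c) (gradient u z)) hN' hp1 hq hK hR hdz0 ?_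
    (norm_nonneg (gradient u z)) (φeq z hdz0) hzφ ?_ ?_ (key.trans (le_of_eq ?_))
  · simp only [hd]; nlinarith [sq_nonneg ‖z - c‖]
  · refine (abs_real_inner_le_norm _ _).trans ?_
    rw [mul_comm]; gcongr
  · gcongr
  · simp only [hφ]; field_simp; ring

/-- primitive of `-t^(-q)` vanishing at 1 -/
theorem exists_G {q : ℝ} (hq : 1 ≤ q) : ∃ G : ℝ → ℝ, (∀ t, 0 < t → HasDerivAt G (-t ^ (-q)) t) ∧
    G 1 = 0 ∧ (∀ M : ℝ, ∃ τ0, 0 < τ0 ∧ ∀ τ, 0 < τ → τ ≤ τ0 → M < G τ) ∧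
    (∀ s t, 0 < s → s ≤ t → G t ≤ G s) := by
  obtain ⟨G, h1, h2⟩ : ∃ G : ℝ → ℝ, (∀ t, 0 < t → HasDerivAt G (-t ^ (-q)) t) ∧ G 1 = 0 := by
    rcases eq_or_lt_of_le hq with h | h
    · refine ⟨fun t => -Real.log t, fun t ht => ?_, by simp⟩
      have := (Real.hasDerivAt_log ht.ne').neg
      rw [← h, Real.rpow_neg_one]
      exact this
    · refine ⟨fun t => (t ^ (1 - q) - 1) / (q - 1), fun t ht => ?_, by simp⟩
      have := ((Real.hasDerivAt_rpow_const (p := 1 - q) (Or.inl ht.ne')).sub_const 1).div_const (q - 1)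
      refine this.congr_deriv ?_
      have e : 1 - q - 1 = -q := by ring
      rw [e]
      field_simp [show q - 1 ≠ 0 by linarith]
      ring
  have hanti : ∀ s t, 0 < s → s ≤ t → G t ≤ G s := by
    intro s t hs hst
    have : AntitoneOn G (Set.Ioi 0) := by
      refine antitoneOn_of_deriv_nonpos (convex_Ioi 0) (fun x hx => (h1 x hx).continuousAt.continuousWithinAt)
        (fun x hx => ?_) (fun x hx => ?_)
      · rw [interior_Ioi] at hx; exact (h1 x hx).differentiableAt.differentiableWithinAt
      · rw [interior_Ioi] at hx; rw [(h1 x hx).deriv]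
        have := Real.rpow_nonneg (le_of_lt hx) (-q); linarith
    exact this hs (lt_of_lt_of_le hs hst) hst
  have hlog : ∀ t, 0 < t → t ≤ 1 → -Real.log t ≤ G t := by
    intro t ht ht1
    have : AntitoneOn (fun t => G t + Real.log t) (Set.Ioc 0 1) := by
      refine antitoneOn_of_deriv_nonpos (convex_Ioc 0 1)
        (fun x hx => ((h1 x hx.1).add (Real.hasDerivAt_log hx.1.ne')).continuousAt.continuousWithinAt)
        (fun x hx => ?_) (fun x hx => ?_)
      · have hx := interior_subset hx
        exact ((h1 x hx.1).add (Real.hasDerivAt_log hx.1.ne')).differentiableAt.differentiableWithinAt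
      · have hx := interior_subset hx
        have := ((h1 x hx.1).add (Real.hasDerivAt_log hx.1.ne')).deriv
        have e : deriv (fun t => G t + Real.log t) x = -x ^ (-q) + x⁻¹ := this
        rw [e]
        have : x ^ (-1:ℝ) ≤ x ^ (-q) := Real.rpow_le_rpow_of_exponent_ge hx.1 hx.2 (by linarith)
        rw [Real.rpow_neg_one] at this
        linarith
    have := this ⟨ht, ht1⟩ ⟨one_pos, le_refl _⟩ ht1
    simp only [h2, Real.log_one] at this
    linarith
  refine ⟨G, h1, h2, fun M => ?_, hanti⟩
  refine ⟨Real.exp (-(|M| + 1)), Real.exp_pos _, fun τ hτ hτ0 => ?_⟩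
  have hle1 : τ ≤ 1 := hτ0.trans (by rw [Real.exp_le_one_iff]; have := abs_nonneg M; linarith)
  have := hlog τ hτ hle1
  have h3 := Real.log_le_log hτ hτ0
  rw [Real.log_exp] at h3
  have := le_abs_self M
  linarith

theorem mvt_abs {f f' G G' : ℝ → ℝ} {a b : ℝ} (hab : a ≤ b)
    (hf : ∀ t ∈ Set.Icc a b, HasDerivAt f (f' t) t) (hG : ∀ t ∈ Set.Icc a b, HasDerivAt G (G' t) t)
    (hle : ∀ t ∈ Set.Icc a b, |f' t| ≤ G' t) : |f b - f a| ≤ G b - G a := by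
  have m1 : MonotoneOn (fun t => G t - f t) (Set.Icc a b) := by
    refine monotoneOn_of_deriv_nonneg (convex_Icc a b)
      (fun x hx => ((hG x hx).sub (hf x hx)).continuousAt.continuousWithinAt) (fun x hx => ?_) (fun x hx => ?_)
    · have hx := interior_subset hx
      exact ((hG x hx).sub (hf x hx)).differentiableAt.differentiableWithinAt
    · have hx := interior_subset hx
      have e : deriv (fun t => G t - f t) x = _ := ((hG x hx).sub (hf x hx)).deriv
      rw [e]
      have := (abs_le.1 (hle x hx)).2
      linarith
  have m2 : MonotoneOn (fun t => G t + f t) (Set.Icc a b) := by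
    refine monotoneOn_of_deriv_nonneg (convex_Icc a b)
      (fun x hx => ((hG x hx).add (hf x hx)).continuousAt.continuousWithinAt) (fun x hx => ?_) (fun x hx => ?_)
    · have hx := interior_subset hx
      exact ((hG x hx).add (hf x hx)).differentiableAt.differentiableWithinAt
    · have hx := interior_subset hx
      have e : deriv (fun t => G t + f t) x = _ := ((hG x hx).add (hf x hx)).deriv
      rw [e]
      have := (abs_le.1 (hle x hx)).1
      linarith
  have r1 := m1 (Set.left_mem_Icc.2 hab) (Set.right_mem_Icc.2 hab) hab
  have r2 := m2 (Set.left_mem_Icc.2 hab) (Set.right_mem_Icc.2 hab) hab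
  simp only at r1 r2
  rw [abs_le]; constructor <;> linarith

section
variable {n : ℕ}

/-- replace the last coordinate by `t` -/
noncomputable def setLast (x : EuclideanSpace ℝ (Fin (n + 1))) (t : ℝ) : EuclideanSpace ℝ (Fin (n + 1)) :=
  x + (t - x (Fin.last n)) • EuclideanSpace.single (Fin.last n) 1

theorem setLast_last (x : EuclideanSpace ℝ (Fin (n + 1))) (t : ℝ) : setLast x t (Fin.last n) = t := by
  simp [setLast]

theorem setLast_self (x : EuclideanSpace ℝ (Fin (n + 1))) : setLast x (x (Fin.last n)) = x := by
  simp [setLast]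

theorem abs_coord_le {N : ℕ} (x : EuclideanSpace ℝ (Fin N)) (i : Fin N) : |x i| ≤ ‖x‖ := by
  have := PiLp.norm_apply_le x i
  simpa using this

theorem grad_bound {p : ℝ} (hp1 : 1 < p) {u : EuclideanSpace ℝ (Fin (n + 1)) → ℝ}
    (hu2 : ContDiffOn ℝ 2 u (halfSpace n))
    (heq : ∀ x ∈ halfSpace n, -laplacian u x = ‖gradient u x‖ ^ p) :
    ∃ C : ℝ, 0 < C ∧ ∀ x : EuclideanSpace ℝ (Fin (n + 1)), 0 < x (Fin.last n) →
      ‖gradient u x‖ ≤ C * (x (Fin.last n)) ^ (-(1 / (p - 1))) := by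
  obtain ⟨K, hK, h⟩ := bernstein_grad (N := n + 1) (Nat.succ_pos n) hp1
  refine ⟨(2 * K) ^ (1 / (p - 1)), by positivity, fun x hx => ?_⟩
  refine (h u _ (isOpen_halfSpace n) hu2 heq x (x (Fin.last n) / 2) (by positivity) ?_).trans (le_of_eq ?_)
  · intro y hy
    rw [Metric.mem_closedBall, dist_eq_norm] at hy
    have := (abs_le.1 ((abs_coord_le (y - x) (Fin.last n)).trans hy)).1
    rw [mem_halfSpace]
    simp at this
    linarith
  · rw [Real.rpow_neg hx.le, ← div_eq_mul_inv, ← Real.div_rpow (by positivity) hx.le]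
    congr 1
    field_simp

theorem hasDerivAt_setLast {u : EuclideanSpace ℝ (Fin (n + 1)) → ℝ}
    (hu2 : ContDiffOn ℝ 2 u (halfSpace n)) (x : EuclideanSpace ℝ (Fin (n + 1))) {t : ℝ} (ht : 0 < t) :
    HasDerivAt (fun t => u (setLast x t)) (fderiv ℝ u (setLast x t) (EuclideanSpace.single (Fin.last n) 1)) t := by
  have hm : setLast x t ∈ halfSpace n := by rw [mem_halfSpace, setLast_last]; exact ht
  have hd : DifferentiableAt ℝ u (setLast x t) :=
    (hu2.contDiffAt ((isOpen_halfSpace n).mem_nhds hm)).differentiableAt (by norm_num)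
  have hl : HasDerivAt (fun t => setLast x t) (EuclideanSpace.single (Fin.last n) (1:ℝ)) t := by
    unfold setLast
    have := (((hasDerivAt_id t).sub_const (x (Fin.last n))).smul_const (EuclideanSpace.single (Fin.last n) (1:ℝ))).const_add x
    simpa using this
  exact hd.hasFDerivAt.comp_hasDerivAt t hl

theorem abs_fderiv_single_le {u : EuclideanSpace ℝ (Fin (n + 1)) → ℝ} (x : EuclideanSpace ℝ (Fin (n + 1)))
    (i : Fin (n + 1)) : |fderiv ℝ u x (EuclideanSpace.single i 1)| ≤ ‖gradient u x‖ := by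
  rw [gradient_coord]; exact abs_coord_le _ _

/-- growth bound away from the boundary -/
theorem growth_far {q : ℝ} (hq : 1 ≤ q) {u : EuclideanSpace ℝ (Fin (n + 1)) → ℝ} {C : ℝ} (hC : 0 < C)
    (hu2 : ContDiffOn ℝ 2 u (halfSpace n))
    (hg : ∀ x : EuclideanSpace ℝ (Fin (n + 1)), 0 < x (Fin.last n) →
      ‖gradient u x‖ ≤ C * (x (Fin.last n)) ^ (-q)) :
    ∃ A : ℝ, 0 < A ∧ ∀ x : EuclideanSpace ℝ (Fin (n + 1)), 1 ≤ x (Fin.last n) →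
      |u x| ≤ A * (1 + ‖x‖) ^ (1 / 4 : ℝ) := by
  have vert : ∀ x : EuclideanSpace ℝ (Fin (n + 1)), ∀ a b : ℝ, 1 ≤ a → a ≤ b →
      |u (setLast x b) - u (setLast x a)| ≤ 4 * C * b ^ (1 / 4 : ℝ) := by
    intro x a b ha hab
    have := mvt_abs (f := fun t => u (setLast x t)) (G := fun t => 4 * C * t ^ (1 / 4 : ℝ))
      (G' := fun t => 4 * C * ((1 / 4 : ℝ) * t ^ ((1 / 4 : ℝ) - 1))) hab
      (fun t ht => hasDerivAt_setLast hu2 x (by linarith [ht.1]))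
      (fun t ht => (Real.hasDerivAt_rpow_const (Or.inl (by linarith [ht.1]))).const_mul _) ?_
    · have h0 : 0 ≤ 4 * C * a ^ (1 / 4 : ℝ) := by positivity
      linarith
    · intro t ht
      have ht1 : 1 ≤ t := ha.trans ht.1
      refine (abs_fderiv_single_le _ _).trans ((hg _ (by rw [setLast_last]; linarith)).trans ?_)
      rw [setLast_last]
      have : t ^ (-q) ≤ t ^ ((1 / 4 : ℝ) - 1) := Real.rpow_le_rpow_of_exponent_le ht1 (by linarith)
      nlinarith
  have hor : ∀ x y : EuclideanSpace ℝ (Fin (n + 1)), ∀ r : ℝ, 1 ≤ r → 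
      |u (setLast x r) - u (setLast y r)| ≤ C / r * ‖setLast x r - setLast y r‖ := by
    intro x y r hr
    have hcv : Convex ℝ {z : EuclideanSpace ℝ (Fin (n + 1)) | r ≤ z (Fin.last n)} := by
      intro a ha b hb s t hs ht hst
      simp at ha hb ⊢
      nlinarith
    have := hcv.norm_image_sub_le_of_norm_fderiv_le (𝕜 := ℝ) (f := u) (C := C / r)
      (x := setLast y r) (y := setLast x r) ?_ ?_ ?_ ?_
    · simpa using this
    · intro z hz
      simp at hz
      exact (hu2.contDiffAt ((isOpen_halfSpace n).mem_nhds (by rw [mem_halfSpace]; linarith))).differentiableAt (by norm_num)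
    · intro z hz
      simp at hz
      have h1 : ‖fderiv ℝ u z‖ = ‖gradient u z‖ := by
        unfold gradient; simp
      rw [h1]
      refine (hg z (by linarith)).trans ?_
      rw [div_eq_mul_inv]
      have h2 : z (Fin.last n) ^ (-q) ≤ z (Fin.last n) ^ (-1:ℝ) :=
        Real.rpow_le_rpow_of_exponent_le (by linarith) (by linarith)
      rw [Real.rpow_neg_one] at h2
      have h3 : (z (Fin.last n))⁻¹ ≤ r⁻¹ := inv_anti₀ (by linarith) hz
      exact mul_le_mul_of_nonneg_left (h2.trans h3) hC.le
    · simp [setLast_last]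
    · simp [setLast_last]
  refine ⟨|u (setLast 0 1)| + 10 * C, by positivity, fun x hx => ?_⟩
  set r := 1 + ‖x‖ with hr
  have hxr : x (Fin.last n) ≤ ‖x‖ := (le_abs_self _).trans (abs_coord_le x _)
  have hr1 : 1 ≤ r := by have := norm_nonneg x; linarith
  have e1 := vert x (x (Fin.last n)) r hx (by linarith)
  rw [setLast_self] at e1
  have e2 := vert 0 1 r le_rfl hr1
  have e3 := hor x 0 r hr1
  have e4 : ‖setLast x r - setLast 0 r‖ ≤ 2 * r := by
    have : setLast x r - setLast 0 r = x - x (Fin.last n) • EuclideanSpace.single (Fin.last n) (1:ℝ) := by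
      simp only [setLast, PiLp.zero_apply]; module
    rw [this]
    refine (norm_sub_le _ _).trans ?_
    rw [norm_smul]
    have := abs_coord_le x (Fin.last n)
    simp only [Real.norm_eq_abs, PiLp.norm_single, abs_one, mul_one] 
    linarith
  have e5 : C / r * ‖setLast x r - setLast 0 r‖ ≤ 2 * C := by
    calc _ ≤ C / r * (2 * r) := by gcongr
      _ = 2 * C := by field_simp
  have hr4 : 1 ≤ r ^ (1 / 4 : ℝ) := Real.one_le_rpow hr1 (by norm_num)
  have e6 : |u x| ≤ |u (setLast 0 1)| + 8 * C * r ^ (1 / 4 : ℝ) + 2 * C := by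
    have a1 := abs_le.1 e1
    have a2 := abs_le.1 e2
    have a3 := abs_le.1 (e3.trans e5)
    have a4 := abs_le.1 (le_refl |u (setLast 0 1)|)
    rw [abs_le]; constructor <;> linarith [a1.1, a1.2, a2.1, a2.2, a3.1, a3.2, a4.1, a4.2]
  refine e6.trans ?_
  nlinarith [abs_nonneg (u (setLast 0 1))]

theorem growth_near {q : ℝ} {u : EuclideanSpace ℝ (Fin (n + 1)) → ℝ} {C : ℝ} 
    (hu2 : ContDiffOn ℝ 2 u (halfSpace n))
    (hg : ∀ x : EuclideanSpace ℝ (Fin (n + 1)), 0 < x (Fin.last n) →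
      ‖gradient u x‖ ≤ C * (x (Fin.last n)) ^ (-q))
    {G : ℝ → ℝ} (hG : ∀ t, 0 < t → HasDerivAt G (-t ^ (-q)) t) (hG1 : G 1 = 0)
    (x : EuclideanSpace ℝ (Fin (n + 1))) (hx : 0 < x (Fin.last n)) (hx1 : x (Fin.last n) ≤ 1) :
    |u (setLast x 1) - u x| ≤ C * G (x (Fin.last n)) := by
  have := mvt_abs (f := fun t => u (setLast x t)) (G := fun t => -C * G t)
      (G' := fun t => -C * (-t ^ (-q))) hx1
      (fun t ht => hasDerivAt_setLast hu2 x (by linarith [ht.1]))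
      (fun t ht => (hG t (by linarith [ht.1])).const_mul _) ?_
  · simp only [setLast_self, hG1] at this
    linarith
  · intro t ht
    refine (abs_fderiv_single_le _ _).trans ((hg _ (by rw [setLast_last]; linarith [ht.1])).trans ?_)
    rw [setLast_last]; simp

end

theorem exists_mu (n : ℕ) {q C p : ℝ} (hp1 : 1 < p) :
    ∃ μ : ℝ, 0 < μ ∧ μ ≤ 1 / (4 * (n + 1)) ∧ 8 * q * μ + 9 * C ^ (p - 1) * μ ^ (p - 1) < 1 := by
  have hc : ContinuousAt (fun μ : ℝ => 8 * q * μ + 9 * C ^ (p - 1) * μ ^ (p - 1)) 0 := by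
    refine ContinuousAt.add (by fun_prop) (continuousAt_const.mul ?_)
    exact continuousAt_id.rpow_const (Or.inr (by simp; linarith))
  have h1 : ∀ᶠ μ in 𝓝 (0:ℝ), 8 * q * μ + 9 * C ^ (p - 1) * μ ^ (p - 1) < 1 := by
    refine hc.eventually (gt_mem_nhds ?_)
    simp only
    rw [Real.zero_rpow (by linarith)]; simp
  have h2 : ∀ᶠ μ in 𝓝 (0:ℝ), μ < 1 / (4 * ((n:ℝ) + 1)) := gt_mem_nhds (by positivity)
  have h3 : ∀ᶠ μ in 𝓝[>] (0:ℝ), 0 < μ := eventually_mem_nhdsWithin.mono (fun x hx => hx)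
  obtain ⟨μ, ha, hb, hc⟩ := ((h1.filter_mono nhdsWithin_le_nhds).and ((h2.filter_mono nhdsWithin_le_nhds).and h3)).exists
  exact ⟨μ, hc, hb.le, ha⟩

/-- algebra for the wedge barrier -/
theorem wedge_algebra {n : ℕ} {p q C μ z η ζ A B b : ℝ} (hq : q = 1 / (p - 1)) (hp1 : 1 < p) (hp2 : p ≤ 2) (hC : 0 < C)
    (hμ0 : 0 < μ) (hμ1 : μ ≤ 1 / (4 * (n + 1))) (hμ2 : 8 * q * μ + 9 * C ^ (p - 1) * μ ^ (p - 1) < 1)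
    (hη0 : 0 < η) (hημ : η ≤ μ) (hz0 : 0 < z) (hzη : z < η) 
    (hζ : ζ = η - 2 * μ * z + μ * z ^ 2 / η) (hA0 : 0 ≤ A) (hA : A ^ 2 ≤ 8 * μ ^ 2)
    (hb : -(2 * μ) * n ≤ b) (hB : B = 2 * μ / η + b)
    (h : C * ζ ^ (-q) * B - C * (q * ζ ^ (-q - 1)) * A ^ 2 ≤ (C * ζ ^ (-q) * A) ^ p) : False := by
  have hq0 : 0 < q := by rw [hq]; apply div_pos one_pos; linarith
  have hn : (0:ℝ) ≤ n := Nat.cast_nonneg n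
  have hμn : μ * (n + 1) ≤ 1 / 4 := by
    calc μ * (n + 1) ≤ 1 / (4 * ((n:ℝ) + 1)) * (n + 1) := by gcongr
      _ = 1 / 4 := by field_simp
  have hμ4 : μ ≤ 1 / 4 := by nlinarith
  have hζη : η * (1 - μ) ≤ ζ := by
    rw [hζ]
    have : μ * z ^ 2 / η - 2 * μ * z + η * μ = μ * (z - η) ^ 2 / η := by field_simp; ring
    have h2 : 0 ≤ μ * (z - η) ^ 2 / η := by positivity
    linarith
  have hζ0 : 0 < ζ := by nlinarith
  have hB0 : (2 * μ / η) * (3 / 4) ≤ B := by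
    have h1 : 2 * μ * n ≤ 2 * μ / η * (1 / 4) := by
      rw [div_mul_eq_mul_div, le_div_iff₀ hη0]; nlinarith
    rw [hB]; linarith
  have hζB : μ ≤ ζ * B := by
    calc μ ≤ (η * (3/4)) * ((2 * μ / η) * (3 / 4)) := by
          have : (η * (3/4)) * ((2 * μ / η) * (3 / 4)) = 9/8 * μ := by field_simp; norm_num
          rw [this]; linarith
      _ ≤ ζ * B := mul_le_mul (by nlinarith) hB0 (by positivity) hζ0.le
  have hA3 : A ≤ 3 * μ := by nlinarith
  have hAp : A ^ p ≤ 9 * (μ * μ ^ (p - 1)) := by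
    calc A ^ p ≤ (3 * μ) ^ p := by gcongr
      _ = 3 ^ p * μ ^ p := Real.mul_rpow (by norm_num) hμ0.le
      _ ≤ 3 ^ (2:ℝ) * μ ^ p := by
          gcongr
          norm_num
      _ = 9 * (μ * μ ^ (p - 1)) := by
          rw [Real.rpow_sub hμ0, Real.rpow_one]; norm_num; field_simp
  have e1 : ζ ^ (-q) = ζ ^ (-q - 1) * ζ := by
    rw [Real.rpow_sub hζ0, Real.rpow_one]; field_simp
  have e2 : (C * ζ ^ (-q) * A) ^ p = C * ζ ^ (-q - 1) * (C ^ (p - 1) * A ^ p) := by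
    rw [Real.mul_rpow (by positivity) hA0, Real.mul_rpow hC.le (by positivity), ← Real.rpow_mul hζ0.le]
    have : -q * p = -q - 1 := by rw [hq]; field_simp [show p - 1 ≠ 0 by linarith]; ring
    rw [this, Real.rpow_sub hC, Real.rpow_one]; field_simp
  rw [e2, e1] at h
  have h3 : C * ζ ^ (-q - 1) * (ζ * B - q * A ^ 2) ≤ C * ζ ^ (-q - 1) * (C ^ (p - 1) * A ^ p) := by
    linarith
  have h4 := le_of_mul_le_mul_left h3 (by positivity)
  have h5 : C ^ (p - 1) * A ^ p ≤ C ^ (p - 1) * (9 * (μ * μ ^ (p - 1))) := by gcongr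
  have h6 : q * A ^ 2 ≤ q * (8 * μ ^ 2) := by gcongr
  have h7 : μ * (8 * q * μ + 9 * C ^ (p - 1) * μ ^ (p - 1)) < μ * 1 := by gcongr
  nlinarith

section
variable {n : ℕ}

theorem norm_sq_last (x : EuclideanSpace ℝ (Fin (n + 1))) :
    ‖x‖ ^ 2 - (x (Fin.last n)) ^ 2 = ∑ i : Fin n, (x i.castSucc) ^ 2 := by
  rw [EuclideanSpace.norm_sq_eq, Fin.sum_univ_castSucc]; simp

set_option maxHeartbeats 1600000 in
/-- the wedge barrier -/
theorem wedge {p q C μ M : ℝ} (hq : q = 1 / (p - 1)) (hp1 : 1 < p) (hp2 : p ≤ 2) (hC : 0 < C)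
    (hμ0 : 0 < μ) (hμ1 : μ ≤ 1 / (4 * (n + 1))) (hμ2 : 8 * q * μ + 9 * C ^ (p - 1) * μ ^ (p - 1) < 1)
    {G : ℝ → ℝ} (hG : ∀ t, 0 < t → HasDerivAt G (-t ^ (-q)) t) (hG1 : G 1 = 0)
    (hGtop : ∀ M : ℝ, ∃ τ0, 0 < τ0 ∧ ∀ τ, 0 < τ → τ ≤ τ0 → M < G τ)
    (hGanti : ∀ s t, 0 < s → s ≤ t → G t ≤ G s)
    {v : EuclideanSpace ℝ (Fin (n + 1)) → ℝ} (hv2 : ContDiffOn ℝ 2 v (halfSpace n))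
    (hvc : ContinuousOn v (closure (halfSpace n)))
    (hv : ∀ x ∈ halfSpace n, -laplacian v x ≤ ‖gradient v x‖ ^ p)
    (hbc : ∀ x : EuclideanSpace ℝ (Fin (n + 1)), x (Fin.last n) = 0 → v x = 0)
    {c : EuclideanSpace ℝ (Fin (n + 1))} (hc : c (Fin.last n) = 0) (hM : 0 ≤ M)
    (hvM : ∀ x : EuclideanSpace ℝ (Fin (n + 1)), 0 < x (Fin.last n) → x (Fin.last n) ≤ 1 →
      ‖x - c‖ ^ 2 - (x (Fin.last n)) ^ 2 ≤ 1 → v x ≤ M + C * G (x (Fin.last n)))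
    {t : ℝ} (ht0 : 0 ≤ t) (htμ : t ≤ μ) :
    v (setLast c t) ≤ M + C * G ((1 - μ) * μ) := by
  have hn : (0:ℝ) ≤ n := Nat.cast_nonneg n
  have hμ4 : μ ≤ 1 / 4 := hμ1.trans (by rw [div_le_div_iff₀ (by positivity) (by norm_num)]; linarith)
  set η : EuclideanSpace ℝ (Fin (n + 1)) → ℝ := fun x => μ * (1 - (‖x - c‖ ^ 2 - (x (Fin.last n)) ^ 2)) with hη
  set ζ : EuclideanSpace ℝ (Fin (n + 1)) → ℝ := fun x => η x - 2 * μ * x (Fin.last n) + μ * (x (Fin.last n)) ^ 2 / η x with hζ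
  have hηc : Continuous η := by rw [hη]; fun_prop
  have hlc : Continuous fun x : EuclideanSpace ℝ (Fin (n + 1)) => x (Fin.last n) := by fun_prop
  have hsq : ∀ x, ‖x - c‖ ^ 2 - (x (Fin.last n)) ^ 2 = ∑ i : Fin n, ((x - c) i.castSucc) ^ 2 := by
    intro x
    rw [← norm_sq_last]; simp [hc]
  have hη_le : ∀ x, η x ≤ μ := by
    intro x
    simp only [hη]; rw [hsq]
    have : 0 ≤ ∑ i : Fin n, ((x - c) i.castSucc) ^ 2 := Finset.sum_nonneg fun i _ => sq_nonneg _
    nlinarith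
  have hη1 : ∀ x, 0 < η x → ‖x - c‖ ^ 2 - (x (Fin.last n)) ^ 2 ≤ 1 := by
    intro x hx
    simp only [hη] at hx
    have := pos_of_mul_pos_right hx hμ0.le
    linarith
  have hζlow : ∀ x, 0 < η x → (1 - μ) * η x ≤ ζ x := by
    intro x hx
    simp only [hζ]
    have : μ * (x (Fin.last n)) ^ 2 / η x - 2 * μ * (x (Fin.last n)) + η x * μ = μ * (x (Fin.last n) - η x) ^ 2 / η x := by
      field_simp; ring
    have h2 : 0 ≤ μ * (x (Fin.last n) - η x) ^ 2 / η x := by positivity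
    linarith
  have hζ0 : ∀ x, 0 < η x → 0 < ζ x := fun x hx => lt_of_lt_of_le (by apply mul_pos _ hx; linarith) (hζlow x hx)
  have hζhigh : ∀ x, 0 < η x → 0 ≤ x (Fin.last n) → x (Fin.last n) ≤ η x → ζ x ≤ η x := by
    intro x hx h0 h1
    simp only [hζ]
    have : μ * (x (Fin.last n)) ^ 2 / η x ≤ μ * x (Fin.last n) := by
      rw [div_le_iff₀ hx]
      have := mul_le_mul_of_nonneg_left h1 (mul_nonneg hμ0.le h0)
      nlinarith
    nlinarith [mul_nonneg hμ0.le h0]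
  have hGnn : ∀ s, 0 < s → s ≤ 1 → 0 ≤ G s := fun s h0 h1 => hG1 ▸ hGanti s 1 h0 h1
  -- compact sets
  have hD0 : IsCompact {x : EuclideanSpace ℝ (Fin (n + 1)) | 0 ≤ x (Fin.last n) ∧ ‖x - c‖ ≤ 2} := by
    refine (isCompact_closedBall c 2).of_isClosed_subset ?_ ?_
    · exact (isClosed_le continuous_const hlc).inter (isClosed_le (continuous_id.sub continuous_const).norm continuous_const)
    · intro x hx
      have hx : 0 ≤ x (Fin.last n) ∧ ‖x - c‖ ≤ 2 := by simpa using hx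
      rw [Metric.mem_closedBall, dist_eq_norm]; exact hx.2
  have hcl : ∀ x : EuclideanSpace ℝ (Fin (n + 1)), 0 ≤ x (Fin.last n) → x ∈ closure (halfSpace n) := by
    intro x hx; rw [closure_halfSpace_eq]; simpa using hx
  obtain ⟨V, hV⟩ := hD0.bddAbove_image (f := v) (hvc.mono fun x hx => hcl x (by
    have hx : 0 ≤ x (Fin.last n) ∧ ‖x - c‖ ≤ 2 := by simpa using hx
    exact hx.1))
  have hV : ∀ x : EuclideanSpace ℝ (Fin (n + 1)), 0 ≤ x (Fin.last n) → ‖x - c‖ ≤ 2 → v x ≤ V := fun x h1 h2 =>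
    hV ⟨x, by simpa using ⟨h1, h2⟩, rfl⟩
  obtain ⟨τ0, hτ0, hτG⟩ := hGtop (|V| / C)
  set τ := min τ0 μ with hτ
  have hτpos : 0 < τ := lt_min hτ0 hμ0
  set D : Set (EuclideanSpace ℝ (Fin (n + 1))) := {x | 0 ≤ x (Fin.last n) ∧ x (Fin.last n) ≤ η x ∧ τ ≤ η x} with hD
  have memD : ∀ x, x ∈ D ↔ 0 ≤ x (Fin.last n) ∧ x (Fin.last n) ≤ η x ∧ τ ≤ η x := fun x => by simp [hD]
  have hDb : ∀ x ∈ D, ‖x - c‖ ≤ 2 := by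
    intro x hx
    rw [memD] at hx
    have h1 := hη1 x (hτpos.trans_le hx.2.2)
    have h2 := hη_le x
    have h3 : x (Fin.last n) ≤ 1 := by linarith
    have h4 := norm_nonneg (x - c)
    nlinarith [hx.1]
  have hDcl : IsClosed D :=
    (isClosed_le continuous_const hlc).inter ((isClosed_le hlc hηc).inter (isClosed_le continuous_const hηc))
  have hDc : IsCompact D := by
    refine (isCompact_closedBall c 2).of_isClosed_subset hDcl fun x hx => ?_
    rw [Metric.mem_closedBall, dist_eq_norm]; exact hDb x hx
  set Φ : EuclideanSpace ℝ (Fin (n + 1)) → ℝ := fun x => M + C * G (ζ x) with hΦ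
  have hΦc : ContinuousOn Φ D := by
    intro x hx
    rw [memD] at hx
    have hx0 : 0 < η x := hτpos.trans_le hx.2.2
    have hζc : ContinuousAt ζ x := by
      refine ContinuousAt.add (by fun_prop) (ContinuousAt.div (by fun_prop) hηc.continuousAt hx0.ne')
    have : ContinuousAt (fun x => G (ζ x)) x := (hG _ (hζ0 x hx0)).continuousAt.comp hζc
    exact (continuousAt_const.add (continuousAt_const.mul this)).continuousWithinAt
  set y := setLast c t with hy
  have hylast : y (Fin.last n) = t := setLast_last c t
  have hyη : η y = μ := by
    have : y - c = t • EuclideanSpace.single (Fin.last n) (1:ℝ) := by simp [hy, setLast, hc]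
    simp only [hη]
    rw [this, hylast, norm_smul]; simp
  have hyD : y ∈ D := by
    rw [memD, hylast, hyη]; exact ⟨ht0, htμ, min_le_right _ _⟩
  obtain ⟨z, hzD, hzmax⟩ := hDc.exists_isMaxOn ⟨y, hyD⟩ ((hvc.mono fun x hx => hcl x ((memD x).1 hx).1).sub hΦc)
  have hyz : v y - Φ y ≤ v z - Φ z := hzmax hyD
  have hyΦ : Φ y ≤ M + C * G ((1 - μ) * μ) := by
    simp only [hΦ]
    have h1 := hζlow y (by rw [hyη]; exact hμ0)
    rw [hyη] at h1
    have := hGanti _ _ (by apply mul_pos _ hμ0; linarith) h1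
    gcongr
  suffices hmain : v z - Φ z ≤ 0 by linarith
  by_contra hcon
  push Not at hcon
  obtain ⟨hz0, hzη, hzτ⟩ := (memD z).1 hzD
  have hηz : 0 < η z := hτpos.trans_le hzτ
  have hζz : 0 < ζ z := hζ0 z hηz
  have hηzμ := hη_le z
  have hζη := hζhigh z hηz hz0 hzη
  have hGζ : 0 ≤ G (ζ z) := hGnn _ hζz (by linarith)
  have hΦM : M ≤ Φ z := by simp only [hΦ]; have := mul_nonneg hC.le hGζ; linarith
  have hz0' : 0 < z (Fin.last n) := by
    rcases hz0.lt_or_eq with h | h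
    · exact h
    · rw [hbc z h.symm] at hcon; linarith
  have hzη' : z (Fin.last n) < η z := by
    rcases hzη.lt_or_eq with h | h
    · exact h
    · exfalso
      have h1 := hvM z hz0' (by linarith) (hη1 z hηz)
      have h2 := hGanti _ _ hζz (hζη.trans h.ge)
      simp only [hΦ] at hcon
      have := mul_le_mul_of_nonneg_left h2 hC.le
      linarith
  have hzτ' : τ < η z := by
    rcases hzτ.lt_or_eq with h | h
    · exact h
    · exfalso
      have h1 := hV z hz0 (hDb z hzD)
      have h2 := hτG (ζ z) hζz (hζη.trans (h ▸ min_le_left _ _))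
      rw [div_lt_iff₀ hC] at h2
      have := le_abs_self V
      simp only [hΦ] at hcon
      linarith
  have hmax : IsLocalMax (fun x => v x - Φ x) z := by
    refine hzmax.isLocalMax ?_
    filter_upwards [hlc.continuousAt.eventually (lt_mem_nhds hz0'), 
      hlc.continuousAt.eventually_lt hηc.continuousAt hzη',
      hηc.continuousAt.eventually (lt_mem_nhds hzτ')] with x h1 h2 h3
    exact (memD x).2 ⟨h1.le, h2.le, h3.le⟩
  have hzH : z ∈ halfSpace n := mem_halfSpace.2 hz0'
  have hvz : ContDiffAt ℝ 2 v z := hv2.contDiffAt ((isOpen_halfSpace n).mem_nhds hzH)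
  -- composition with G
  have hGcomp : ∀ i a b, HasD2 (fun t => ζ (z + t • EuclideanSpace.single i 1)) a b →
      fderiv ℝ v z (EuclideanSpace.single i 1) = C * (-(ζ z) ^ (-q)) * a ∧
      fderiv ℝ (fderiv ℝ v) z (EuclideanSpace.single i 1) (EuclideanSpace.single i 1) ≤
        C * (-(ζ z) ^ (-q)) * b + C * (q * (ζ z) ^ (-q - 1)) * a ^ 2 := by
    intro i a b hab
    have hc := hab.comp (ρ := fun s => M + C * G s)
      (ρ' := fun s => C * (-s ^ (-q)))
      (c := C * (q * (ζ z) ^ (-q - 1))) ?_ ?_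
    · have hd := (hasD2_of_contDiffAt hvz (EuclideanSpace.single i 1)).sub hc
      have hl := isLocalMax_line hmax (EuclideanSpace.single i 1)
      have e1 := hd.fst_eq_zero hl
      have e2 := hd.snd_nonpos hl
      simp only [zero_smul, add_zero] at e1 e2
      constructor <;> linarith
    · simp only [zero_smul, add_zero]
      filter_upwards [lt_mem_nhds hζz] with s hs
      exact ((hG s hs).const_mul C).const_add M
    · simp only [zero_smul, add_zero]
      refine (((Real.hasDerivAt_rpow_const (p := -q) (Or.inl hζz.ne')).neg).const_mul C).congr_deriv ?_
      ring
  set s := z (Fin.last n) with hs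
  -- last direction
  have hlast : HasD2 (fun t => ζ (z + t • EuclideanSpace.single (Fin.last n) 1)) (-(2 * μ) + 2 * μ * s / η z) (2 * (μ / η z)) := by
    refine (HasD2.quad (ζ z) (-(2 * μ) + 2 * μ * s / η z) (μ / η z)).congr (fun t => ?_) rfl rfl
    have h1 : (z + t • EuclideanSpace.single (Fin.last n) (1:ℝ)) (Fin.last n) = s + t := by simp [hs]
    have h2 : η (z + t • EuclideanSpace.single (Fin.last n) (1:ℝ)) = η z := by
      simp only [hη]
      rw [h1, add_sub_right_comm, norm_sq_single]
      simp only [PiLp.sub_apply, hc, hs]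
      ring
    simp only [hζ]
    rw [h1, h2]
    field_simp
    ring
  have hother : ∀ i : Fin n, HasD2 (fun t => ζ (z + t • EuclideanSpace.single i.castSucc 1))
      ((1 - μ * s ^ 2 / (η z) ^ 2) * (-2 * μ * (z - c) i.castSucc))
      ((1 - μ * s ^ 2 / (η z) ^ 2) * (2 * (-μ)) + (2 * μ * s ^ 2 / (η z) ^ 3) * (-2 * μ * (z - c) i.castSucc) ^ 2) := by
    intro i
    have hne : (Fin.last n) ≠ i.castSucc := (Fin.castSucc_lt_last i).ne'
    have h1 : ∀ t : ℝ, (z + t • EuclideanSpace.single i.castSucc (1:ℝ)) (Fin.last n) = s := by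
      intro t; simp [hs, hne]
    have h2 : ∀ t : ℝ, η (z + t • EuclideanSpace.single i.castSucc (1:ℝ)) = η z + (-2 * μ * (z - c) i.castSucc) * t + (-μ) * t ^ 2 := by
      intro t
      simp only [hη]
      rw [h1, add_sub_right_comm, norm_sq_single, hs]
      ring
    have hquad := HasD2.quad (η z) (-2 * μ * (z - c) i.castSucc) (-μ)
    have hc := hquad.comp (ρ := fun r => r - 2 * μ * s + μ * s ^ 2 / r)
      (ρ' := fun r => 1 - μ * s ^ 2 / r ^ 2)
      (c := 2 * μ * s ^ 2 / (η z) ^ 3) ?_ ?_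
    · refine hc.congr (fun t => ?_) ?_ ?_
      · simp only [hζ]; rw [h1, h2]
      · simp
      · simp
    · simp only [mul_zero, add_zero, ne_eq, OfNat.ofNat_ne_zero, not_false_eq_true, zero_pow]
      filter_upwards [lt_mem_nhds hηz] with r hr
      have := ((hasDerivAt_id r).sub_const (2 * μ * s)).add ((hasDerivAt_const r (μ * s ^ 2)).div (hasDerivAt_id r) hr.ne')
      refine this.congr_deriv ?_
      simp; ring
    · simp only [mul_zero, add_zero, ne_eq, OfNat.ofNat_ne_zero, not_false_eq_true, zero_pow]
      have := (hasDerivAt_const (η z) (1:ℝ)).sub ((hasDerivAt_const (η z) (μ * s ^ 2)).div ((hasDerivAt_id (η z)).pow 2) (pow_ne_zero 2 hηz.ne'))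
      refine this.congr_deriv ?_
      simp; field_simp
  set a : Fin n → ℝ := fun i => (1 - μ * s ^ 2 / (η z) ^ 2) * (-2 * μ * (z - c) i.castSucc) with ha
  set b : Fin n → ℝ := fun i => (1 - μ * s ^ 2 / (η z) ^ 2) * (2 * (-μ)) + (2 * μ * s ^ 2 / (η z) ^ 3) * (-2 * μ * (z - c) i.castSucc) ^ 2 with hb
  set aL := -(2 * μ) + 2 * μ * s / η z with haL
  have hratio : 0 ≤ μ * s ^ 2 / (η z) ^ 2 ∧ μ * s ^ 2 / (η z) ^ 2 ≤ 1 := by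
    refine ⟨by positivity, ?_⟩
    rw [div_le_one (by positivity)]
    have : s ^ 2 ≤ (η z) ^ 2 := by gcongr
    nlinarith [sq_nonneg s]
  have hbi : ∀ i, -(2 * μ) ≤ b i := by
    intro i
    simp only [hb]
    have : 0 ≤ (2 * μ * s ^ 2 / (η z) ^ 3) * (-2 * μ * (z - c) i.castSucc) ^ 2 := by positivity
    nlinarith [hratio.1, hratio.2]
  have hai : ∀ i, (a i) ^ 2 ≤ 4 * μ ^ 2 * ((z - c) i.castSucc) ^ 2 := by
    intro i
    simp only [ha]
    rw [mul_pow]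
    have : (1 - μ * s ^ 2 / (η z) ^ 2) ^ 2 ≤ 1 := by nlinarith [hratio.1, hratio.2]
    calc _ ≤ 1 * (-2 * μ * (z - c) i.castSucc) ^ 2 := by gcongr
      _ = _ := by ring
  have haL2 : aL ^ 2 ≤ 4 * μ ^ 2 := by
    have h1 : 2 * μ * s / η z ≤ 2 * μ := by rw [div_le_iff₀ hηz]; nlinarith
    have h2 : 0 ≤ 2 * μ * s / η z := by positivity
    nlinarith
  set A2 := (∑ i, (a i) ^ 2) + aL ^ 2 with hA2
  have hA2nn : 0 ≤ A2 := add_nonneg (Finset.sum_nonneg fun i _ => sq_nonneg _) (sq_nonneg _)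
  have hA2le : A2 ≤ 8 * μ ^ 2 := by
    have : ∑ i, (a i) ^ 2 ≤ 4 * μ ^ 2 * 1 := by
      calc _ ≤ ∑ i : Fin n, 4 * μ ^ 2 * ((z - c) i.castSucc) ^ 2 := Finset.sum_le_sum fun i _ => hai i
        _ = 4 * μ ^ 2 * ∑ i : Fin n, ((z - c) i.castSucc) ^ 2 := by rw [Finset.mul_sum]
        _ ≤ _ := by gcongr; rw [← hsq]; exact hη1 z hηz
    linarith
  have hgrad : ‖gradient v z‖ = C * (ζ z) ^ (-q) * √A2 := by
    have : ‖gradient v z‖ ^ 2 = (C * (ζ z) ^ (-q) * √A2) ^ 2 := by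
      rw [EuclideanSpace.norm_sq_eq, Fin.sum_univ_castSucc, mul_pow, Real.sq_sqrt hA2nn, hA2, mul_add, Finset.mul_sum]
      congr 1
      · refine Finset.sum_congr rfl fun i _ => ?_
        rw [Real.norm_eq_abs, sq_abs, ← gradient_coord, (hGcomp _ _ _ (hother i)).1]; ring
      · rw [Real.norm_eq_abs, sq_abs, ← gradient_coord, (hGcomp _ _ _ hlast).1]; ring
    exact (sq_eq_sq₀ (norm_nonneg _) (by positivity)).1 this
  have hlap : laplacian v z ≤ C * (-(ζ z) ^ (-q)) * (2 * (μ / η z) + ∑ i, b i) + C * (q * (ζ z) ^ (-q - 1)) * A2 := by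
    rw [laplacian_eq, Fin.sum_univ_castSucc]
    have h1 := (hGcomp _ _ _ hlast).2
    have h2 := Finset.sum_le_sum fun i (_ : i ∈ Finset.univ) => (hGcomp _ _ _ (hother i)).2
    refine (add_le_add h2 h1).trans (le_of_eq ?_)
    rw [Finset.sum_add_distrib, ← Finset.mul_sum, ← Finset.mul_sum, hA2]
    ring
  have hfin := hv z hzH
  rw [hgrad] at hfin
  refine wedge_algebra (n := n) (A := √A2) (b := ∑ i, b i) (B := 2 * μ / η z + ∑ i, b i) (z := s) (η := η z) (ζ := ζ z) hq hp1 hp2 hC hμ0 hμ1 hμ2 hηz hηzμ hz0' hzη' rfl (Real.sqrt_nonneg _) ?_ ?_ rfl ?_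
  · rw [Real.sq_sqrt hA2nn]; exact hA2le
  · calc -(2 * μ) * n = ∑ i : Fin n, -(2 * μ) := by simp; ring
      _ ≤ _ := Finset.sum_le_sum fun i _ => hbi i
  · rw [Real.sq_sqrt hA2nn]
    refine le_trans ?_ hfin
    have : 2 * (μ / η z) = 2 * μ / η z := by ring
    rw [this] at hlap
    linarith

end

section
variable {n : ℕ}

theorem fderiv_neg_fun {N : ℕ} (u : EuclideanSpace ℝ (Fin N) → ℝ) :
    fderiv ℝ (fun y => -u y) = fun y => -fderiv ℝ u y := by
  funext y; exact fderiv_fun_neg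

theorem laplacian_neg {N : ℕ} (u : EuclideanSpace ℝ (Fin N) → ℝ) (x : EuclideanSpace ℝ (Fin N)) :
    laplacian (fun y => -u y) x = -laplacian u x := by
  rw [laplacian_eq, laplacian_eq, ← Finset.sum_neg_distrib]
  refine Finset.sum_congr rfl fun i _ => ?_
  rw [fderiv_neg_fun, fderiv_fun_neg]; rfl

theorem gradient_neg {N : ℕ} (u : EuclideanSpace ℝ (Fin N) → ℝ) (x : EuclideanSpace ℝ (Fin N)) :
    ‖gradient (fun y => -u y) x‖ = ‖gradient u x‖ := by
  unfold gradient
  rw [fderiv_neg_fun]; simp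

theorem norm_setLast_le (x : EuclideanSpace ℝ (Fin (n + 1))) (t : ℝ) :
    ‖setLast x t‖ ≤ ‖x‖ + |t - x (Fin.last n)| := by
  unfold setLast
  refine (norm_add_le _ _).trans ?_
  rw [norm_smul]; simp

theorem growth {p : ℝ} (hp1 : 1 < p) (hp2 : p ≤ 2)
    {u : EuclideanSpace ℝ (Fin (n + 1)) → ℝ}
    (hu2 : ContDiffOn ℝ 2 u (halfSpace n))
    (huc : ContinuousOn u (closure (halfSpace n)))
    (heq : ∀ x ∈ halfSpace n, -laplacian u x = ‖gradient u x‖ ^ p)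
    (hbc : ∀ x : EuclideanSpace ℝ (Fin (n + 1)), x (Fin.last n) = 0 → u x = 0) :
    ∃ A : ℝ, 0 < A ∧ ∀ x : EuclideanSpace ℝ (Fin (n + 1)), 0 ≤ x (Fin.last n) →
      |u x| ≤ A * (1 + ‖x‖) ^ (1 / 4 : ℝ) := by
  obtain ⟨C, hC, hg⟩ := grad_bound hp1 hu2 heq
  set q := 1 / (p - 1) with hq
  have hq1 : 1 ≤ q := by rw [hq, le_div_iff₀ (by linarith)]; linarith
  obtain ⟨A, hA, hfar⟩ := growth_far hq1 hC hu2 hg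
  obtain ⟨G, hG, hG1, hGtop, hGanti⟩ := exists_G hq1
  obtain ⟨μ, hμ0, hμ1, hμ2⟩ := exists_mu n (q := q) (C := C) hp1
  have hn : (0:ℝ) ≤ n := Nat.cast_nonneg n
  have hμ4 : μ ≤ 1 / 4 := hμ1.trans (by rw [div_le_div_iff₀ (by positivity) (by norm_num)]; linarith)
  set g := G ((1 - μ) * μ) with hgdef
  have hgμ : G μ ≤ g := hGanti _ _ (by apply mul_pos _ hμ0; linarith) (by nlinarith)
  have hg0 : 0 ≤ g := by
    refine le_trans ?_ hgμ
    rw [← hG1]; exact hGanti _ _ hμ0 (by linarith)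
  have h6 : ∀ r : ℝ, 0 ≤ r → (6 + r) ^ (1 / 4 : ℝ) ≤ 6 * (1 + r) ^ (1 / 4 : ℝ) := by
    intro r hr
    calc (6 + r) ^ (1 / 4 : ℝ) ≤ (6 * (1 + r)) ^ (1 / 4 : ℝ) := by
          apply Real.rpow_le_rpow (by linarith) (by linarith) (by norm_num)
      _ = 6 ^ (1 / 4 : ℝ) * (1 + r) ^ (1 / 4 : ℝ) := Real.mul_rpow (by norm_num) (by linarith)
      _ ≤ 6 ^ (1 : ℝ) * (1 + r) ^ (1 / 4 : ℝ) := by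
          gcongr
          · norm_num
          · norm_num
      _ = _ := by rw [Real.rpow_one]
  -- near the boundary, in terms of a bound at height one
  have hnear : ∀ x : EuclideanSpace ℝ (Fin (n + 1)), ∀ r : ℝ, 0 < x (Fin.last n) → x (Fin.last n) ≤ 1 →
      2 + ‖x‖ ≤ r → |u x| ≤ A * r ^ (1 / 4 : ℝ) + C * G (x (Fin.last n)) := by
    intro x r h0 h1 hr
    have e1 := growth_near hu2 hg hG hG1 x h0 h1
    have e2 := hfar (setLast x 1) (by rw [setLast_last])
    have e3 := norm_setLast_le x 1
    have e4 : |1 - x (Fin.last n)| ≤ 1 := by rw [abs_le]; constructor <;> linarith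
    have e5 : (1 + ‖setLast x 1‖) ^ (1 / 4 : ℝ) ≤ r ^ (1 / 4 : ℝ) :=
      Real.rpow_le_rpow (by positivity) (by linarith) (by norm_num)
    have e6 : |u (setLast x 1)| ≤ A * r ^ (1 / 4 : ℝ) := e2.trans (by gcongr)
    have a1 := abs_le.1 e1
    have a2 := abs_le.1 e6
    rw [abs_le]; constructor <;> linarith [a1.1, a1.2, a2.1, a2.2]
  refine ⟨6 * A + C * g, by positivity, fun x hx => ?_⟩
  have hr1 : 1 ≤ (1 + ‖x‖) ^ (1 / 4 : ℝ) := Real.one_le_rpow (by linarith [norm_nonneg x]) (by norm_num)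
  have hfinal : |u x| ≤ A * (6 + ‖x‖) ^ (1 / 4 : ℝ) + C * g → |u x| ≤ (6 * A + C * g) * (1 + ‖x‖) ^ (1 / 4 : ℝ) := by
    intro h
    have h7 := mul_le_mul_of_nonneg_left (h6 ‖x‖ (norm_nonneg x)) hA.le
    have h8 : C * g * 1 ≤ C * g * (1 + ‖x‖) ^ (1 / 4 : ℝ) := by gcongr
    linarith
  rcases le_total 1 (x (Fin.last n)) with h1 | h1
  · have := hfar x h1
    have h9 : 0 ≤ (5 * A + C * g) * (1 + ‖x‖) ^ (1 / 4 : ℝ) := by positivity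
    linarith
  apply hfinal
  rcases le_total μ (x (Fin.last n)) with h2 | h2
  · refine (hnear x (6 + ‖x‖) (by linarith) h1 (by linarith)).trans ?_
    have := hGanti _ _ hμ0 h2
    gcongr
    linarith
  set c := setLast x 0 with hc
  have hcl : c (Fin.last n) = 0 := setLast_last x 0
  have hcx : setLast c (x (Fin.last n)) = x := by
    rw [setLast, hcl, hc, setLast]; module
  have hcn : ‖c‖ ≤ ‖x‖ + 1 := by
    refine (norm_setLast_le x 0).trans ?_
    rw [zero_sub, abs_neg, abs_of_nonneg hx]; linarith
  have hball : ∀ y : EuclideanSpace ℝ (Fin (n + 1)), 0 < y (Fin.last n) → y (Fin.last n) ≤ 1 →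
      ‖y - c‖ ^ 2 - (y (Fin.last n)) ^ 2 ≤ 1 → |u y| ≤ A * (6 + ‖x‖) ^ (1 / 4 : ℝ) + C * G (y (Fin.last n)) := by
    intro y h0 h1 h3
    refine hnear y _ h0 h1 ?_
    have h4 : ‖y - c‖ ≤ 2 := by nlinarith [norm_nonneg (y - c)]
    have h5 : ‖y‖ ≤ ‖y - c‖ + ‖c‖ := by
      have := norm_add_le (y - c) c; rwa [sub_add_cancel] at this
    linarith
  have hM0 : 0 ≤ A * (6 + ‖x‖) ^ (1 / 4 : ℝ) := by positivity
  have w1 := wedge hq hp1 hp2 hC hμ0 hμ1 hμ2 hG hG1 hGtop hGanti hu2 huc (fun x hx => (heq x hx).le) hbc hcl hM0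
    (fun y a b d => (le_abs_self _).trans (hball y a b d)) hx h2
  have w2 := wedge (v := fun y => -u y) hq hp1 hp2 hC hμ0 hμ1 hμ2 hG hG1 hGtop hGanti hu2.neg huc.neg (fun x hx => by
    rw [laplacian_neg, gradient_neg, heq x hx]
    have : 0 ≤ ‖gradient u x‖ ^ p := by positivity
    linarith) (fun x hx => by rw [hbc x hx, neg_zero]) hcl hM0
    (fun y a b d => (neg_le_abs _).trans (hball y a b d)) hx h2
  rw [hcx] at w1 w2
  rw [abs_le]; constructor <;> linarith

end

theorem convex_num {p ε a c Q : ℝ} (hp : 1 ≤ p) (hε : 0 < ε) (ha : 0 ≤ a) (hc : 0 ≤ c) (hQ : 0 ≤ Q)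
    (h : (1 + ε) * Q ≤ a + ε * c) : (1 + ε) * Q ^ p ≤ a ^ p + ε * c ^ p := by
  have hθ : 0 < 1 + ε := by linarith
  have h1 : Q ≤ (1 / (1 + ε)) * a + (ε / (1 + ε)) * c := by
    have : (1 / (1 + ε)) * a + (ε / (1 + ε)) * c = (a + ε * c) / (1 + ε) := by field_simp
    rw [this, le_div_iff₀ hθ]; linarith
  have h2 := (convexOn_rpow hp).2 (show a ∈ Set.Ici (0:ℝ) from ha) (show c ∈ Set.Ici (0:ℝ) from hc)
    (show 0 ≤ 1 / (1 + ε) by positivity) (show 0 ≤ ε / (1 + ε) by positivity) (by field_simp)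
  simp only [smul_eq_mul] at h2
  have h3 := (Real.rpow_le_rpow hQ h1 (by linarith : 0 ≤ p)).trans h2
  have : (1 / (1 + ε)) * a ^ p + (ε / (1 + ε)) * c ^ p = (a ^ p + ε * c ^ p) / (1 + ε) := by field_simp
  rw [this, le_div_iff₀ hθ] at h3
  linarith

theorem quarter_bound {δ T : ℝ} (hδ : 0 < δ) (hT : 0 ≤ T) : T ^ (1 / 4 : ℝ) ≤ δ⁻¹ + δ ^ 3 * T := by
  set y := T ^ (1 / 4 : ℝ) with hy
  have hy0 : 0 ≤ y := by positivity
  have hT4 : T = y ^ 4 := by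
    rw [hy, ← Real.rpow_natCast, ← Real.rpow_mul hT]; norm_num
  rw [hT4]
  rcases le_total y δ⁻¹ with h | h
  · have : 0 ≤ δ ^ 3 * y ^ 4 := by positivity
    linarith
  · have h1 : 1 ≤ δ * y := by
      have := mul_le_mul_of_nonneg_left h hδ.le
      rwa [mul_inv_cancel₀ hδ.ne'] at this
    have h2 : 1 ≤ (δ * y) ^ 3 := one_le_pow₀ h1
    have h3 : 0 < δ⁻¹ := by positivity
    have : δ ^ 3 * y ^ 4 = (δ * y) ^ 3 * y := by ring
    rw [this]; nlinarith

section
variable {N : ℕ}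

theorem sum_coord_smul (e : EuclideanSpace ℝ (Fin N)) :
    ∑ i, e i • EuclideanSpace.single i (1:ℝ) = e := by
  ext j
  simp [Finset.sum_apply, Pi.single_apply]

/-- trace is invariant under reflection -/
theorem trace_reflect (B : EuclideanSpace ℝ (Fin N) →L[ℝ] EuclideanSpace ℝ (Fin N) →L[ℝ] ℝ)
    (e : EuclideanSpace ℝ (Fin N)) (he : ‖e‖ = 1) :
    ∑ i, B (EuclideanSpace.single i 1 + (-2 * e i) • e) (EuclideanSpace.single i 1 + (-2 * e i) • e) =
      ∑ i, B (EuclideanSpace.single i 1) (EuclideanSpace.single i 1) := by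
  have hsq : ∑ i, (e i) ^ 2 = 1 := by
    have := EuclideanSpace.norm_sq_eq e
    rw [he] at this; simp at this; exact this.symm
  have h1 : ∑ i, e i * B (EuclideanSpace.single i 1) e = B e e := by
    have : B (∑ i, e i • EuclideanSpace.single i (1:ℝ)) e = ∑ i, e i * B (EuclideanSpace.single i 1) e := by
      rw [map_sum, sum_apply]; simp
    rw [← this, sum_coord_smul]
  have h2 : ∑ i, e i * B e (EuclideanSpace.single i 1) = B e e := by
    have : B e (∑ i, e i • EuclideanSpace.single i (1:ℝ)) = ∑ i, e i * B e (EuclideanSpace.single i 1) := by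
      rw [map_sum]; simp
    rw [← this, sum_coord_smul]
  have h3 : ∀ i, B (EuclideanSpace.single i 1 + (-2 * e i) • e) (EuclideanSpace.single i 1 + (-2 * e i) • e) =
      B (EuclideanSpace.single i 1) (EuclideanSpace.single i 1) + (-2) * (e i * B (EuclideanSpace.single i 1) e)
       + (-2) * (e i * B e (EuclideanSpace.single i 1)) + 4 * B e e * (e i) ^ 2 := by
    intro i
    simp only [map_add, map_smul, add_apply, smul_apply, smul_eq_mul]
    ring
  simp_rw [h3]
  rw [Finset.sum_add_distrib, Finset.sum_add_distrib, Finset.sum_add_distrib, ← Finset.mul_sum, ← Finset.mul_sum,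
    ← Finset.mul_sum, h1, h2, hsq]
  ring

/-- `g = √(1+|x|²)` -/
noncomputable def gfun (x : EuclideanSpace ℝ (Fin N)) : ℝ := √(1 + ‖x‖ ^ 2)

theorem gfun_pos (x : EuclideanSpace ℝ (Fin N)) : 0 < gfun x := Real.sqrt_pos.2 (by positivity)

theorem gfun_sq (x : EuclideanSpace ℝ (Fin N)) : gfun x ^ 2 = 1 + ‖x‖ ^ 2 := Real.sq_sqrt (by positivity)

theorem one_le_gfun (x : EuclideanSpace ℝ (Fin N)) : 1 ≤ gfun x := by
  have := gfun_sq x; have := gfun_pos x; nlinarith [sq_nonneg ‖x‖]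

theorem norm_le_gfun (x : EuclideanSpace ℝ (Fin N)) : ‖x‖ ≤ gfun x := by
  have := gfun_sq x; have := gfun_pos x; nlinarith [norm_nonneg x]

theorem continuous_gfun : Continuous (gfun (N := N)) := by unfold gfun; fun_prop

theorem gfun_hasD2 (x : EuclideanSpace ℝ (Fin N)) (i : Fin N) :
    ∃ b, b ≤ 1 ∧ HasD2 (fun t => gfun (x + t • EuclideanSpace.single i 1)) (x i / gfun x) b := by
  have hg := gfun_pos x
  have hpos : 0 < 1 + ‖x‖ ^ 2 := by positivity
  have hquad := HasD2.quad (1 + ‖x‖ ^ 2) (2 * x i) 1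
  have hc := hquad.comp (ρ := fun r => √r) (ρ' := fun r => 1 / (2 * √r))
    (c := -(1 / gfun x) / (2 * gfun x) ^ 2) ?_ ?_
  · refine ⟨_, ?_, hc.congr (fun t => ?_) ?_ rfl⟩
    · simp only [mul_zero, add_zero, ne_eq, OfNat.ofNat_ne_zero, not_false_eq_true, zero_pow]
      have e : √(1 + ‖x‖ ^ 2) = gfun x := rfl
      rw [e]
      have h1 : 1 / (2 * gfun x) * (2 * 1) ≤ 1 := by
        have := one_le_gfun x
        rw [div_mul_eq_mul_div, div_le_one (by positivity)]; linarith
      have h2 : -(1 / gfun x) / (2 * gfun x) ^ 2 * (2 * x i) ^ 2 ≤ 0 := by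
        have : 0 ≤ (1 / gfun x) / (2 * gfun x) ^ 2 * (2 * x i) ^ 2 := by positivity
        rw [neg_div, neg_mul]; linarith
      linarith
    · simp only [gfun]; rw [norm_sq_single]; ring_nf
    · simp only [mul_zero, add_zero, ne_eq, OfNat.ofNat_ne_zero, not_false_eq_true, zero_pow]
      have e : √(1 + ‖x‖ ^ 2) = gfun x := rfl
      rw [e]; field_simp
  · simp only [mul_zero, add_zero, ne_eq, OfNat.ofNat_ne_zero, not_false_eq_true, zero_pow]
    filter_upwards [lt_mem_nhds hpos] with r hr
    exact Real.hasDerivAt_sqrt hr.ne'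
  · simp only [mul_zero, add_zero, ne_eq, OfNat.ofNat_ne_zero, not_false_eq_true, zero_pow]
    have e : √(1 + ‖x‖ ^ 2) = gfun x := rfl
    have h1 := (Real.hasDerivAt_sqrt hpos.ne').const_mul 2
    have h2 := (hasDerivAt_const (1 + ‖x‖ ^ 2) (1:ℝ)).div h1 (by rw [e]; positivity)
    refine h2.congr_deriv ?_
    rw [e]; field_simp; ring

end

section
variable {n : ℕ}

set_option maxHeartbeats 1600000 in
theorem two_point {p : ℝ} (hp1 : 1 < p)
    {u : EuclideanSpace ℝ (Fin (n + 1)) → ℝ}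
    (hu2 : ContDiffOn ℝ 2 u (halfSpace n))
    (huc : ContinuousOn u (closure (halfSpace n)))
    (heq : ∀ x ∈ halfSpace n, -laplacian u x = ‖gradient u x‖ ^ p)
    (hbc : ∀ x : EuclideanSpace ℝ (Fin (n + 1)), x (Fin.last n) = 0 → u x = 0)
    {A : ℝ} (hA : 0 < A) (hgr : ∀ x : EuclideanSpace ℝ (Fin (n + 1)), 0 ≤ x (Fin.last n) →
      |u x| ≤ A * (1 + ‖x‖) ^ (1 / 4 : ℝ))
    {e : EuclideanSpace ℝ (Fin (n + 1))} (he : ‖e‖ = 1) (hel : e (Fin.last n) = 0)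
    {Λ M : ℝ} (hΛ : Λ = 6 * A + 1) (hM : M = 4 * A + Λ ^ p + Λ * (n + 1))
    {δ : ℝ} (hδ : 0 < δ) (hδ1 : δ ≤ 1) (x : EuclideanSpace ℝ (Fin (n + 1))) (hx : 0 ≤ x (Fin.last n))
    {s : ℝ} (hs : 0 ≤ s) (hsR : s ≤ (δ⁻¹) ^ 2) :
    (1 + δ ^ 3) * u x - u (x + s • e) ≤ δ ^ 3 * Λ * gfun x + M * (2 * δ * s - δ ^ 3 * s ^ 2) := by
  have hΛ0 : 0 < Λ := by linarith
  have hΛp : 0 < Λ ^ p := by positivity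
  have hM0 : 0 < M := by rw [hM]; positivity
  set ε := δ ^ 3 with hε
  have hε0 : 0 < ε := by positivity
  have hε1 : ε ≤ 1 := pow_le_one₀ hδ.le hδ1
  set R := (δ⁻¹) ^ 2 with hR
  have hR0 : 0 < R := by positivity
  have hεR : ε * R = δ := by rw [hε, hR]; field_simp
  have hδi : δ ≤ δ⁻¹ := by
    have : 1 ≤ δ⁻¹ := (one_le_inv₀ hδ).2 hδ1
    linarith
  have hδi0 : 0 < δ⁻¹ := by positivity
  set Ψ : ℝ → ℝ := fun s => M * (2 * δ * s - ε * s ^ 2) with hΨ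
  have hΨnn : ∀ s, 0 ≤ s → s ≤ R → 0 ≤ Ψ s := by
    intro s h0 h1
    simp only [hΨ]
    have : ε * s ≤ δ := by rw [← hεR]; gcongr
    have : 0 ≤ 2 * δ * s - ε * s ^ 2 := by nlinarith
    positivity
  have hΨR : Ψ R = M * δ⁻¹ := by
    simp only [hΨ, hR, hε]; field_simp; ring
  have hlast : ∀ (x : EuclideanSpace ℝ (Fin (n + 1))) (s : ℝ), (x + s • e) (Fin.last n) = x (Fin.last n) := by
    intro x s; simp [hel]
  have hcl : ∀ x : EuclideanSpace ℝ (Fin (n + 1)), 0 ≤ x (Fin.last n) → x ∈ closure (halfSpace n) := by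
    intro x hx; rw [closure_halfSpace_eq]; simpa using hx
  -- growth
  have hgr1 : ∀ x : EuclideanSpace ℝ (Fin (n + 1)), 0 ≤ x (Fin.last n) → |u x| ≤ A * (δ⁻¹ + ε * (1 + ‖x‖)) := by
    intro x hx
    refine (hgr x hx).trans ?_
    have := quarter_bound (T := 1 + ‖x‖) hδ (by positivity)
    gcongr
  have hgrF : ∀ (x : EuclideanSpace ℝ (Fin (n + 1))) (s : ℝ), 0 ≤ x (Fin.last n) → 0 ≤ s → s ≤ R →
      (1 + ε) * u x - u (x + s • e) ≤ 4 * A * δ⁻¹ + 6 * A * ε * gfun x := by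
    intro x s hx h0 h1
    have a1 := (le_abs_self _).trans (hgr1 x hx)
    have a2 := (neg_le_abs _).trans (hgr1 (x + s • e) (by rw [hlast]; exact hx))
    have a3 : ‖x + s • e‖ ≤ ‖x‖ + R := by
      refine (norm_add_le _ _).trans ?_
      rw [norm_smul, he, Real.norm_of_nonneg h0]; linarith
    have a4 : 1 + ‖x‖ ≤ 2 * gfun x := by linarith [one_le_gfun x, norm_le_gfun x]
    have a5 : A * (δ⁻¹ + ε * (1 + ‖x‖)) ≤ A * (δ⁻¹ + ε * (2 * gfun x)) := by gcongr
    have a6 : A * (δ⁻¹ + ε * (1 + ‖x + s • e‖)) ≤ A * (δ⁻¹ + ε * (2 * gfun x + R)) := by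
      have a0 : 1 + ‖x + s • e‖ ≤ 2 * gfun x + R := by linarith
      exact mul_le_mul_of_nonneg_left (by
        have := mul_le_mul_of_nonneg_left a0 hε0.le
        linarith) hA.le
    have a7 : A * (ε * R) ≤ A * δ⁻¹ := by rw [hεR]; gcongr
    have a8 : 0 ≤ A * (δ⁻¹ + ε * (2 * gfun x)) := by have := gfun_pos x; positivity
    have a9 : (1 + ε) * u x ≤ (1 + ε) * (A * (δ⁻¹ + ε * (2 * gfun x))) := by gcongr; linarith
    have a10 : (1 + ε) * (A * (δ⁻¹ + ε * (2 * gfun x))) ≤ 2 * (A * (δ⁻¹ + ε * (2 * gfun x))) := by gcongr; linarith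
    linarith
  set F : EuclideanSpace ℝ (Fin (n + 1)) × ℝ → ℝ := fun z =>
    (1 + ε) * u z.1 - u (z.1 + z.2 • e) - ε * Λ * gfun z.1 - Ψ z.2 with hF
  set ρ := ‖x‖ + 4 * A * δ⁻¹ / ε + 1 with hρ
  set D : Set (EuclideanSpace ℝ (Fin (n + 1)) × ℝ) := {z | (0 ≤ z.1 (Fin.last n) ∧ ‖z.1‖ ≤ ρ) ∧ 0 ≤ z.2 ∧ z.2 ≤ R} with hD
  have memD : ∀ z, z ∈ D ↔ (0 ≤ z.1 (Fin.last n) ∧ ‖z.1‖ ≤ ρ) ∧ 0 ≤ z.2 ∧ z.2 ≤ R := fun z => by simp [hD]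
  have hlc : Continuous fun z : EuclideanSpace ℝ (Fin (n + 1)) × ℝ => z.1 (Fin.last n) := by fun_prop
  have hnc : Continuous fun z : EuclideanSpace ℝ (Fin (n + 1)) × ℝ => ‖z.1‖ := by fun_prop
  have hDcl : IsClosed D :=
    ((isClosed_le continuous_const hlc).inter (isClosed_le hnc continuous_const)).inter
      ((isClosed_le continuous_const continuous_snd).inter (isClosed_le continuous_snd continuous_const))
  have hDc : IsCompact D := by
    refine ((isCompact_closedBall (0 : EuclideanSpace ℝ (Fin (n + 1))) ρ).prod (isCompact_Icc (a := (0:ℝ)) (b := R))).of_isClosed_subset hDcl fun z hz => ?_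
    rw [memD] at hz
    refine ⟨?_, hz.2⟩
    rw [Metric.mem_closedBall, dist_zero_right]; exact hz.1.2
  have hFc : ContinuousOn F D := by
    have c1 : ContinuousOn (fun z : EuclideanSpace ℝ (Fin (n + 1)) × ℝ => u z.1) D :=
      huc.comp continuous_fst.continuousOn fun z hz => hcl _ ((memD z).1 hz).1.1
    have c2 : ContinuousOn (fun z : EuclideanSpace ℝ (Fin (n + 1)) × ℝ => u (z.1 + z.2 • e)) D :=
      huc.comp (by fun_prop) fun z hz => hcl _ (by rw [hlast]; exact ((memD z).1 hz).1.1)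
    have c3 : Continuous fun z : EuclideanSpace ℝ (Fin (n + 1)) × ℝ => ε * Λ * gfun z.1 :=
      continuous_const.mul (continuous_gfun.comp continuous_fst)
    have c4 : Continuous fun z : EuclideanSpace ℝ (Fin (n + 1)) × ℝ => Ψ z.2 := by
      simp only [hΨ]; fun_prop
    exact (((continuousOn_const.mul c1).sub c2).sub c3.continuousOn).sub c4.continuousOn
  have hxD : (x, s) ∈ D := by
    rw [memD]
    refine ⟨⟨hx, ?_⟩, hs, hsR⟩
    have : 0 ≤ 4 * A * δ⁻¹ / ε := by positivity
    simp only; linarith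
  obtain ⟨z, hzD, hzmax⟩ := hDc.exists_isMaxOn ⟨_, hxD⟩ hFc
  have hxz : F (x, s) ≤ F z := hzmax hxD
  suffices hmain : F z ≤ 0 by
    have := hxz.trans hmain
    simp only [hF, hΨ] at this
    linarith
  by_contra hcon
  push Not at hcon
  obtain ⟨a, r⟩ := z
  obtain ⟨⟨ha0, haρ⟩, hr0, hrR⟩ := (memD _).1 hzD
  simp only at ha0 haρ hr0 hrR
  have hFa : F (a, r) = (1 + ε) * u a - u (a + r • e) - ε * Λ * gfun a - Ψ r := rfl
  rw [hFa] at hcon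
  have hg0 := gfun_pos a
  have hga := hgrF a r ha0 hr0 hrR
  have hΛg : ε * Λ * gfun a = 6 * A * ε * gfun a + ε * gfun a := by rw [hΛ]; ring
  have hεg : 0 < ε * gfun a := by positivity
  have hΨr := hΨnn r hr0 hrR
  have ha0' : 0 < a (Fin.last n) := by
    rcases ha0.lt_or_eq with h | h
    · exact h
    · exfalso
      rw [hbc a h.symm, hbc (a + r • e) (by rw [hlast]; exact h.symm)] at hcon
      have : 0 ≤ ε * Λ * gfun a := by positivity
      linarith
  have haρ' : ‖a‖ < ρ := by
    rcases haρ.lt_or_eq with h | h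
    · exact h
    · exfalso
      have h1 : 4 * A * δ⁻¹ / ε ≤ gfun a := by
        have := norm_le_gfun a; have := norm_nonneg x; linarith
      rw [div_le_iff₀ hε0] at h1
      linarith
  have hrR' : r < R := by
    rcases hrR.lt_or_eq with h | h
    · exact h
    · exfalso
      rw [h, hΨR] at hcon
      rw [h] at hga
      have h1 : 4 * A * δ⁻¹ ≤ M * δ⁻¹ := by
        gcongr
        have : 0 ≤ Λ * ((n:ℝ) + 1) := by positivity
        linarith
      linarith
  have hr0' : 0 < r := by
    rcases hr0.lt_or_eq with h | h
    · exact h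
    · exfalso
      rw [← h] at hcon
      simp only [zero_smul, add_zero] at hcon
      have hΨ0 : Ψ 0 = 0 := by simp [hΨ]
      rw [hΨ0] at hcon
      have h1 := (le_abs_self _).trans (hgr a ha0)
      have h2 : (1 + ‖a‖) ^ (1 / 4 : ℝ) ≤ 2 * gfun a := by
        calc (1 + ‖a‖) ^ (1 / 4 : ℝ) ≤ (1 + ‖a‖) ^ (1 : ℝ) :=
              Real.rpow_le_rpow_of_exponent_le (by linarith [norm_nonneg a]) (by norm_num)
          _ = 1 + ‖a‖ := Real.rpow_one _
          _ ≤ 2 * gfun a := by linarith [one_le_gfun a, norm_le_gfun a]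
      have h3 : A * (1 + ‖a‖) ^ (1 / 4 : ℝ) ≤ A * (2 * gfun a) := by gcongr
      have h4 : ε * u a ≤ ε * (A * (2 * gfun a)) := by gcongr; linarith
      have h5 : 0 < ε * A * gfun a := by positivity
      linarith
  have hmax : IsLocalMax F (a, r) := by
    refine hzmax.isLocalMax ?_
    filter_upwards [hlc.continuousAt.eventually (lt_mem_nhds ha0'), hnc.continuousAt.eventually (gt_mem_nhds haρ'),
      continuous_snd.continuousAt.eventually (lt_mem_nhds hr0'), continuous_snd.continuousAt.eventually (gt_mem_nhds hrR')]
      with z h1 h2 h3 h4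
    exact (memD z).2 ⟨⟨h1.le, h2.le⟩, h3.le, h4.le⟩
  set y := a + r • e with hy
  have haH : a ∈ halfSpace n := mem_halfSpace.2 ha0'
  have hyH : y ∈ halfSpace n := mem_halfSpace.2 (by rw [hy, hlast]; exact ha0')
  have hua : ContDiffAt ℝ 2 u a := hu2.contDiffAt ((isOpen_halfSpace n).mem_nhds haH)
  have huy : ContDiffAt ℝ 2 u y := hu2.contDiffAt ((isOpen_halfSpace n).mem_nhds hyH)
  -- variation along a line
  have hline : ∀ (i : Fin (n + 1)) (σ : ℝ) (g1 g2 : ℝ),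
      HasD2 (fun t => gfun (a + t • EuclideanSpace.single i 1)) g1 g2 →
      (1 + ε) * fderiv ℝ u a (EuclideanSpace.single i 1) - fderiv ℝ u y (EuclideanSpace.single i 1 + σ • e)
        - ε * Λ * g1 - M * (2 * δ * σ - 2 * ε * r * σ) = 0 ∧
      (1 + ε) * fderiv ℝ (fderiv ℝ u) a (EuclideanSpace.single i 1) (EuclideanSpace.single i 1)
        - fderiv ℝ (fderiv ℝ u) y (EuclideanSpace.single i 1 + σ • e) (EuclideanSpace.single i 1 + σ • e)
        - ε * Λ * g2 - 2 * (-(M * ε * σ ^ 2)) ≤ 0 := by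
    intro i σ g1 g2 hg
    have d1 := (hasD2_of_contDiffAt hua (EuclideanSpace.single i 1)).const_mul (1 + ε)
    have d2 := hasD2_of_contDiffAt huy (EuclideanSpace.single i 1 + σ • e)
    have d3 := hg.const_mul (ε * Λ)
    have d4 := HasD2.quad (Ψ r) (M * (2 * δ * σ - 2 * ε * r * σ)) (-(M * ε * σ ^ 2))
    have d := ((d1.sub d2).sub d3).sub d4
    have hl : IsLocalMax (fun t : ℝ => F (a + t • EuclideanSpace.single i 1, r + t * σ)) 0 := by
      have hcont : ContinuousAt (fun t : ℝ => ((a + t • EuclideanSpace.single i (1:ℝ), r + t * σ) : EuclideanSpace ℝ (Fin (n + 1)) × ℝ)) 0 := by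
        fun_prop
      have hm : ∀ᶠ z in 𝓝 (a, r), F z ≤ F (a, r) := hmax
      have h0 : ((a + (0:ℝ) • EuclideanSpace.single i (1:ℝ), r + 0 * σ) : EuclideanSpace ℝ (Fin (n + 1)) × ℝ) = (a, r) := by simp
      have hm2 := hcont.eventually (by simp only [h0]; exact hm)
      show ∀ᶠ t in 𝓝 (0:ℝ), F (a + t • EuclideanSpace.single i 1, r + t * σ) ≤ F (a + (0:ℝ) • EuclideanSpace.single i 1, r + 0 * σ)
      rw [h0]
      exact hm2
    have d' := d.congr (g := fun t : ℝ => F (a + t • EuclideanSpace.single i 1, r + t * σ)) (fun t => by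
      simp only [hF]
      have e1 : a + t • EuclideanSpace.single i (1:ℝ) + (r + t * σ) • e = y + t • (EuclideanSpace.single i 1 + σ • e) := by
        rw [hy]; module
      rw [e1]
      have e2 : Ψ (r + t * σ) = Ψ r + M * (2 * δ * σ - 2 * ε * r * σ) * t + -(M * ε * σ ^ 2) * t ^ 2 := by
        simp only [hΨ]; ring
      rw [e2]) rfl rfl
    exact ⟨d'.fst_eq_zero hl, d'.snd_nonpos hl⟩
  choose g2 hg2 hgD using gfun_hasD2 a
  -- gradient relation
  have hgradrel : ∀ i, (1 + ε) * gradient u a i = gradient u y i + ε * Λ * (a i / gfun a) := by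
    intro i
    have := (hline i 0 _ _ (hgD i)).1
    simp only [zero_smul, add_zero, mul_zero, sub_zero] at this
    rw [gradient_coord, gradient_coord] at this
    linarith
  have hgv : (1 + ε) • gradient u a = gradient u y + (ε * Λ / gfun a) • a := by
    ext i
    simp only [PiLp.smul_apply, PiLp.add_apply, smul_eq_mul]
    rw [hgradrel]; ring
  have hgn : (1 + ε) * ‖gradient u a‖ ≤ ‖gradient u y‖ + ε * Λ := by
    have h1 : (1 + ε) * ‖gradient u a‖ = ‖(1 + ε) • gradient u a‖ := by
      rw [norm_smul, Real.norm_of_nonneg (by linarith)]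
    rw [h1, hgv]
    refine (norm_add_le _ _).trans ?_
    rw [norm_smul, Real.norm_of_nonneg (by positivity)]
    have : ε * Λ / gfun a * ‖a‖ ≤ ε * Λ := by
      rw [div_mul_eq_mul_div, div_le_iff₀ hg0]
      have := norm_le_gfun a
      gcongr
    linarith
  have hconv := convex_num hp1.le hε0 (norm_nonneg (gradient u y)) hΛ0.le (norm_nonneg (gradient u a)) hgn
  -- second order
  have hsum := Finset.sum_le_sum fun i (_ : i ∈ (Finset.univ : Finset (Fin (n + 1)))) => (hline i (-2 * e i) _ _ (hgD i)).2
  have hesq : ∑ i, (e i) ^ 2 = 1 := by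
    have := EuclideanSpace.norm_sq_eq e
    rw [he] at this; simp at this; exact this.symm
  have hlast2 : ∑ i, 2 * (-(M * ε * (-2 * e i) ^ 2)) = -(8 * M * ε) := by
    have : ∀ i, 2 * (-(M * ε * (-2 * e i) ^ 2)) = -(8 * M * ε) * (e i) ^ 2 := fun i => by ring
    simp_rw [this]
    rw [← Finset.mul_sum, hesq, mul_one]
  rw [Finset.sum_sub_distrib, Finset.sum_sub_distrib, Finset.sum_sub_distrib, ← Finset.mul_sum, ← Finset.mul_sum,
    trace_reflect _ e he, ← laplacian_eq, ← laplacian_eq, hlast2, Finset.sum_const_zero] at hsum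
  have hg2s : ∑ i, g2 i ≤ (n:ℝ) + 1 := by
    calc ∑ i, g2 i ≤ ∑ i : Fin (n + 1), (1:ℝ) := Finset.sum_le_sum fun i _ => hg2 i
      _ = _ := by simp
  have hea := heq a haH
  have hey := heq y hyH
  have h1 : ε * Λ * ∑ i, g2 i ≤ ε * Λ * (n + 1) := by gcongr
  have h2 : laplacian u a = -‖gradient u a‖ ^ p := by linarith
  have h3 : laplacian u y = -‖gradient u y‖ ^ p := by linarith
  rw [h2, h3] at hsum
  have h4 : 8 * M * ε ≤ ε * (Λ ^ p + Λ * (n + 1)) := by linarith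
  have h5 : 8 * M ≤ Λ ^ p + Λ * (n + 1) := by
    refine le_of_mul_le_mul_left ?_ hε0
    linarith
  have h6 : 0 ≤ Λ * ((n:ℝ) + 1) := by positivity
  linarith

theorem mono_dir {p : ℝ} (hp1 : 1 < p) (hp2 : p ≤ 2)
    {u : EuclideanSpace ℝ (Fin (n + 1)) → ℝ}
    (hu2 : ContDiffOn ℝ 2 u (halfSpace n))
    (huc : ContinuousOn u (closure (halfSpace n)))
    (heq : ∀ x ∈ halfSpace n, -laplacian u x = ‖gradient u x‖ ^ p)
    (hbc : ∀ x : EuclideanSpace ℝ (Fin (n + 1)), x (Fin.last n) = 0 → u x = 0)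
    {e : EuclideanSpace ℝ (Fin (n + 1))} (he : ‖e‖ = 1) (hel : e (Fin.last n) = 0)
    (x : EuclideanSpace ℝ (Fin (n + 1))) (hx : 0 ≤ x (Fin.last n))
    {s : ℝ} (hs : 0 ≤ s) : u x ≤ u (x + s • e) := by
  obtain ⟨A, hA, hgr⟩ := growth hp1 hp2 hu2 huc heq hbc
  set Λ := 6 * A + 1 with hΛ
  set M := 4 * A + Λ ^ p + Λ * (n + 1) with hM
  have hev : ∀ᶠ δ in 𝓝[>] (0:ℝ), (1 + δ ^ 3) * u x - u (x + s • e) ≤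
      δ ^ 3 * Λ * gfun x + M * (2 * δ * s - δ ^ 3 * s ^ 2) := by
    have h1 : ∀ᶠ δ in 𝓝[>] (0:ℝ), 0 < δ := eventually_mem_nhdsWithin.mono (fun x hx => hx)
    have h2 : ∀ᶠ δ in 𝓝[>] (0:ℝ), δ < 1 / (1 + s) :=
      (gt_mem_nhds (by positivity : (0:ℝ) < 1 / (1 + s))).filter_mono nhdsWithin_le_nhds
    filter_upwards [h1, h2] with δ hδ hδ2
    rw [lt_div_iff₀ (by positivity)] at hδ2
    have hδ1 : δ ≤ 1 := by nlinarith
    refine two_point hp1 hu2 huc heq hbc hA hgr he hel hΛ hM hδ hδ1 x hx hs ?_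
    have h3 : 1 + s ≤ δ⁻¹ := by
      rw [← one_div, le_div_iff₀ hδ]; linarith
    nlinarith
  have t1 : Tendsto (fun δ : ℝ => (1 + δ ^ 3) * u x - u (x + s • e)) (𝓝[>] 0) (𝓝 (u x - u (x + s • e))) := by
    have : Continuous fun δ : ℝ => (1 + δ ^ 3) * u x - u (x + s • e) := by fun_prop
    have := this.tendsto 0
    simp only [ne_eq, OfNat.ofNat_ne_zero, not_false_eq_true, zero_pow, add_zero, one_mul] at this
    exact this.mono_left nhdsWithin_le_nhds
  have t2 : Tendsto (fun δ : ℝ => δ ^ 3 * Λ * gfun x + M * (2 * δ * s - δ ^ 3 * s ^ 2)) (𝓝[>] 0) (𝓝 0) := by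
    have : Continuous fun δ : ℝ => δ ^ 3 * Λ * gfun x + M * (2 * δ * s - δ ^ 3 * s ^ 2) := by fun_prop
    have := this.tendsto 0
    simp only [ne_eq, OfNat.ofNat_ne_zero, not_false_eq_true, zero_pow, add_zero, zero_mul, mul_zero, sub_zero] at this
    exact this.mono_left nhdsWithin_le_nhds
  have := le_of_tendsto_of_tendsto t1 t2 hev
  linarith

end

/-- Main theorem: for `1 < p ≤ 2`, any classical solution of `-Δu = |∇u|^p`
in the half-space with zero boundary data depends only on the last variable `xₙ`. -/
theorem one_dimensionality_subquadratic (n : ℕ) (p : ℝ) (hp1 : 1 < p) (hp2 : p ≤ 2)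
    (u : EuclideanSpace ℝ (Fin (n + 1)) → ℝ)
    (hu2 : ContDiffOn ℝ 2 u (halfSpace n))
    (huc : ContinuousOn u (closure (halfSpace n)))
    (heq : ∀ x ∈ halfSpace n, -laplacian u x = ‖gradient u x‖ ^ p)
    (hbc : ∀ x : EuclideanSpace ℝ (Fin (n + 1)), x (Fin.last n) = 0 → u x = 0) :
    ∀ x ∈ closure (halfSpace n), ∀ y ∈ closure (halfSpace n),
      x (Fin.last n) = y (Fin.last n) → u x = u y := by
  have key : ∀ x y : EuclideanSpace ℝ (Fin (n + 1)), 0 ≤ x (Fin.last n) → x (Fin.last n) = y (Fin.last n) → u x ≤ u y := by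
    intro x y hx hxy
    rcases eq_or_ne x y with h | h
    · rw [h]
    · have hne : ‖y - x‖ ≠ 0 := by rw [norm_ne_zero_iff, sub_ne_zero]; exact h.symm
      have := mono_dir hp1 hp2 hu2 huc heq hbc (e := ‖y - x‖⁻¹ • (y - x))
        (by rw [norm_smul, norm_inv, norm_norm, inv_mul_cancel₀ hne]) (by simp [hxy]) x hx (norm_nonneg (y - x))
      rwa [smul_smul, mul_inv_cancel₀ hne, one_smul, add_sub_cancel] at this
  intro x hx y hy hxy
  have hx0 : 0 ≤ x (Fin.last n) := by rw [closure_halfSpace_eq] at hx; simpa using hx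
  exact le_antisymm (key x y hx0 hxy) (key y x (hxy ▸ hx0) hxy.symm)
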